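/- arXiv:2507.05371 — 3 statements merged into one kernel-verified Lean document; each statement's English description precedes it below -/
import Mathlib

section
/- Let a be a compact totally disconnected subset of ℝ², and let c and d be nonempty compact perfect totally disconnected subsets of ℝ² with a ⊆ c and a ⊆ d, such that a is nowhere dense in the subspace c and nowhere dense in the subspace d. Then there exists a self-homeomorphism h of ℝ² with h x = x for all x ∈ a and h '' d = c. -/
section PlaneHomeomorphisms

open Set Topology Filter

theorem exists_homeomorph_of_fiberwise {f : ℝ → ℝ → ℝ} (hf : Continuous fun z : ℝ × ℝ => f z.1 z.2)
    (hmono : ∀ y, StrictMono fun x => f x y) {C : ℝ} (hC : ∀ x y, |f x y - x| ≤ C) :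
    ∃ h : ℝ × ℝ ≃ₜ ℝ × ℝ, ∀ z, h z = (f z.1 z.2, z.2) := by
  have hcont : Continuous fun z : ℝ × ℝ => (f z.1 z.2, z.2) := hf.prodMk continuous_snd
  have hproper : IsProperMap fun z : ℝ × ℝ => (f z.1 z.2, z.2) := by
    refine isProperMap_iff_tendsto_cocompact.2 ⟨hcont, ?_⟩
    rw [← Metric.cobounded_eq_cocompact, ← tendsto_norm_atTop_iff_cobounded]
    have hle : ∀ z : ℝ × ℝ, ‖z‖ - C ≤ ‖(f z.1 z.2, z.2)‖ := by
      intro z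
      have h1 := norm_sub_norm_le z (z - (f z.1 z.2, z.2))
      have h2 : ‖z - (f z.1 z.2, z.2)‖ ≤ C := by
        have : z - (f z.1 z.2, z.2) = (z.1 - f z.1 z.2, 0) := by ext <;> simp
        rw [this, Prod.norm_def]
        simp only [norm_zero, Real.norm_eq_abs, sup_le_iff]
        have := hC z.1 z.2
        rw [abs_sub_comm] at this
        exact ⟨this, (abs_nonneg _).trans this⟩
      rw [sub_sub_cancel] at h1
      linarith
    refine tendsto_atTop_mono hle ?_
    exact tendsto_atTop_add_const_right _ (-C) (tendsto_norm_cobounded_atTop)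
  have hbij : Function.Bijective fun z : ℝ × ℝ => (f z.1 z.2, z.2) := by
    constructor
    · rintro ⟨x, y⟩ ⟨x', y'⟩ h
      simp only [Prod.mk.injEq] at h
      obtain ⟨h1, rfl⟩ := h
      rw [(hmono y).injective h1]
    · rintro ⟨x, y⟩
      have hc : Continuous fun t => f t y := hf.comp (continuous_id.prodMk continuous_const)
      obtain ⟨t, ht⟩ := mem_range_of_exists_le_of_exists_ge (c := x) hc
        ⟨x - C, by have := abs_le.1 (hC (x - C) y); linarith⟩
        ⟨x + C, by have := abs_le.1 (hC (x + C) y); linarith⟩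
      exact ⟨(t, y), by simpa using ht⟩
  exact ⟨IsHomeomorph.homeomorph _
    (isHomeomorph_iff_continuous_isClosedMap_bijective.2 ⟨hcont, hproper.isClosedMap, hbij⟩),
    fun z => rfl⟩

theorem exists_push {a b b' c : ℝ} (hab : a < b) (hbb : b ≤ b') (hbc : b' < c) :
    ∃ f : ℝ → ℝ, Continuous f ∧ StrictMono f ∧ f b = b' ∧ (∀ x, x ≤ f x) ∧
      ∀ x, x ≤ a ∨ c ≤ x → f x = x := by
  have h1 : 0 < (b' - a) / (b - a) := div_pos (by linarith) (by linarith)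
  have h2 : 0 < (c - b') / (c - b) := div_pos (by linarith) (by linarith)
  have e1 : 1 ≤ (b' - a) / (b - a) := (one_le_div (by linarith)).2 (by linarith)
  have e2 : (c - b') / (c - b) ≤ 1 := (div_le_one (by linarith)).2 (by linarith)
  set s := (b' - a) / (b - a) with hs
  set t := (c - b') / (c - b) with ht
  have s1 : s * (b - a) = b' - a := div_mul_cancel₀ _ (by linarith)
  have t1 : t * (c - b) = c - b' := div_mul_cancel₀ _ (by linarith)
  refine ⟨fun x => max x (min (a + s * (x - a)) (c - t * (c - x))), by fun_prop, ?_, ?_, ?_, ?_⟩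
  · intro x y h
    refine max_lt_max h (min_lt_min ?_ ?_) <;> nlinarith
  · simp only [s1, t1]; simp [hbb]
  · intro x; exact le_max_left _ _
  · intro x hx
    refine max_eq_left ?_
    rcases hx with hx | hx
    · exact (min_le_left _ _).trans (by nlinarith)
    · exact (min_le_right _ _).trans (by nlinarith)

theorem exists_bump {u u' v' v : ℝ} (hu : u < u') (hv : v' < v) :
    ∃ χ : ℝ → ℝ, Continuous χ ∧ (∀ y, 0 ≤ χ y) ∧ (∀ y, χ y ≤ 1) ∧
      (∀ y, u' ≤ y → y ≤ v' → χ y = 1) ∧ ∀ y, y ≤ u ∨ v ≤ y → χ y = 0 := by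
  refine ⟨fun y => max 0 (min 1 (min ((y - u) / (u' - u)) ((v - y) / (v - v')))), by fun_prop,
    fun y => le_max_left _ _, fun y => max_le zero_le_one (min_le_left _ _), ?_, ?_⟩
  · intro y h1 h2
    have h3 : 1 ≤ (y - u) / (u' - u) := (one_le_div (by linarith)).2 (by linarith)
    have h4 : 1 ≤ (v - y) / (v - v') := (one_le_div (by linarith)).2 (by linarith)
    simp only
    rw [min_eq_left (le_min h3 h4)]
    simp
  · intro y h
    refine max_eq_left ((min_le_right _ _).trans ?_)
    rcases h with h | h
    · exact (min_le_left _ _).trans (div_nonpos_of_nonpos_of_nonneg (by linarith) (by linarith))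
    · exact (min_le_right _ _).trans (div_nonpos_of_nonpos_of_nonneg (by linarith) (by linarith))

theorem exists_homeomorph_push {a b b' c u u' v' v : ℝ} (hab : a < b) (hbb : b ≤ b')
    (hbc : b' < c) (hu : u < u') (hv : v' < v) :
    ∃ h : ℝ × ℝ ≃ₜ ℝ × ℝ, (∀ z, (h z).2 = z.2) ∧ (∀ z, z.1 ≤ (h z).1) ∧
      (∀ z, z.1 ≤ a ∨ c ≤ z.1 ∨ z.2 ≤ u ∨ v ≤ z.2 → h z = z) ∧
      (∀ z, z.1 ≤ c → (h z).1 ≤ c) ∧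
      ∀ z, b ≤ z.1 → u' ≤ z.2 → z.2 ≤ v' → b' ≤ (h z).1 := by
  obtain ⟨f, hfc, hfm, hfb, hfle, hfid⟩ := exists_push hab hbb hbc
  obtain ⟨χ, hχc, hχ0, hχ1, hχ, hχz⟩ := exists_bump hu hv
  obtain ⟨h, hh⟩ := exists_homeomorph_of_fiberwise (f := fun x y => (1 - χ y) * x + χ y * f x)
    (by fun_prop) (C := c - a) (by
      intro y x x' hx
      have := hfm hx
      have h0 := hχ0 y
      have h1 := hχ1 y
      simp only
      rcases h0.eq_or_lt with h | h
      · rw [← h]; linarith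
      · nlinarith) (by
      intro x y
      have h0 := hχ0 y
      have h1 := hχ1 y
      have key : (1 - χ y) * x + χ y * f x - x = χ y * (f x - x) := by ring
      have hle := hfle x
      rw [key, abs_of_nonneg (mul_nonneg h0 (by linarith))]
      by_cases hx : x ≤ a ∨ c ≤ x
      · rw [hfid x hx]; simp; linarith
      · push Not at hx
        have : f x < c := by
          have := hfm hx.2
          rwa [hfid c (Or.inr le_rfl)] at this
        nlinarith)
  have hfix : ∀ z : ℝ × ℝ, z.1 ≤ a ∨ c ≤ z.1 ∨ z.2 ≤ u ∨ v ≤ z.2 → h z = z := by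
    intro z hz
    rw [hh]
    ext
    · simp only
      rcases hz with hz | hz | hz | hz
      · rw [hfid _ (Or.inl hz)]; ring
      · rw [hfid _ (Or.inr hz)]; ring
      · rw [hχz _ (Or.inl hz)]; ring
      · rw [hχz _ (Or.inr hz)]; ring
    · rfl
  refine ⟨h, fun z => by rw [hh], fun z => ?_, hfix, fun z hz => ?_, fun z h1 h2 h3 => ?_⟩
  · rw [hh]; have := hfle z.1; have := hχ0 z.2; simp only; nlinarith
  · by_contra! hlt
    have := h.injective (hfix (h z) (Or.inr (Or.inl hlt.le)))
    rw [this] at hlt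
    linarith
  · rw [hh, hχ _ h2 h3]; simp only [sub_self, zero_mul, one_mul, zero_add]
    rw [← hfb]; exact hfm.monotone h1

theorem exists_homeomorph_push_up {a b b' c u u' v' v : ℝ} (hab : a < b) (hbb : b ≤ b')
    (hbc : b' < c) (hu : u < u') (hv : v' < v) :
    ∃ h : ℝ × ℝ ≃ₜ ℝ × ℝ, (∀ z, (h z).1 = z.1) ∧ (∀ z, z.2 ≤ (h z).2) ∧
      (∀ z, z.2 ≤ a ∨ c ≤ z.2 ∨ z.1 ≤ u ∨ v ≤ z.1 → h z = z) ∧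
      (∀ z, z.2 ≤ c → (h z).2 ≤ c) ∧
      ∀ z, b ≤ z.2 → u' ≤ z.1 → z.1 ≤ v' → b' ≤ (h z).2 := by
  obtain ⟨h, h1, h2, h3, h4, h5⟩ := exists_homeomorph_push hab hbb hbc hu hv
  let φ := Homeomorph.prodComm ℝ ℝ
  refine ⟨φ.trans (h.trans φ.symm), fun z => h1 z.swap, fun z => h2 z.swap, fun z hz => ?_,
    fun z => h4 z.swap, fun z => h5 z.swap⟩
  change (h z.swap).swap = z
  rw [h3 z.swap hz, Prod.swap_swap]

theorem exists_homeomorph_push_down {a b b' c u u' v' v : ℝ} (hab : b < a) (hbb : b' ≤ b)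
    (hbc : c < b') (hu : u < u') (hv : v' < v) :
    ∃ h : ℝ × ℝ ≃ₜ ℝ × ℝ, (∀ z, (h z).1 = z.1) ∧ (∀ z, (h z).2 ≤ z.2) ∧
      (∀ z, a ≤ z.2 ∨ z.2 ≤ c ∨ z.1 ≤ u ∨ v ≤ z.1 → h z = z) ∧
      (∀ z, c ≤ z.2 → c ≤ (h z).2) ∧
      ∀ z, z.2 ≤ b → u' ≤ z.1 → z.1 ≤ v' → (h z).2 ≤ b' := by
  obtain ⟨h, h1, h2, h3, h4, h5⟩ :=
    exists_homeomorph_push_up (neg_lt_neg hab) (neg_le_neg hbb) (neg_lt_neg hbc) hu hv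
  let φ := (Homeomorph.refl ℝ).prodCongr (Homeomorph.neg ℝ)
  have e : ∀ z, (φ.trans (h.trans φ.symm)) z = ((h (z.1, -z.2)).1, -(h (z.1, -z.2)).2) :=
    fun z => rfl
  refine ⟨φ.trans (h.trans φ.symm), fun z => ?_, fun z => ?_, fun z hz => ?_, fun z hz => ?_,
    fun z hz h6 h7 => ?_⟩ <;> rw [e]
  · exact h1 _
  · exact neg_le.1 (h2 (z.1, -z.2))
  · rw [h3]
    · simp
    · simpa using hz
  · exact le_neg.1 (h4 (z.1, -z.2) (neg_le_neg hz))
  · exact neg_le.1 (h5 (z.1, -z.2) (neg_le_neg hz) h6 h7)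

theorem IsCompact.exists_pos_forall_le {X : Type*} [TopologicalSpace X] {S : Set X}
    (hS : IsCompact S) {f : X → ℝ} (hf : Continuous f) (hpos : ∀ z ∈ S, 0 < f z) :
    ∃ ε > 0, ∀ z ∈ S, ε ≤ f z :=
  hS.exists_forall_le' hf.continuousOn hpos

theorem exists_homeomorph_evict {K : Set (ℝ × ℝ)} (hK : IsCompact K) {l r w p q s t : ℝ}
    (hlr : l < r) (hrw : r < w) (hps : p ≤ s) (hst : s < t) (htq : t ≤ q)
    (hl : ∀ y, p ≤ y → y ≤ q → (l, y) ∉ K) (hp : ∀ x, l ≤ x → x ≤ r → (x, p) ∉ K)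
    (hq : ∀ x, l ≤ x → x ≤ r → (x, q) ∉ K) (hs : ∀ y, p ≤ y → y ≤ s → (r, y) ∉ K)
    (ht : ∀ y, t ≤ y → y ≤ q → (r, y) ∉ K) :
    ∃ h : ℝ × ℝ ≃ₜ ℝ × ℝ,
      (∀ z, z ∉ Icc l r ×ˢ Icc p q → z ∉ Icc r w ×ˢ Ioo s t → h z = z) ∧
      ∀ z ∈ K, h z ∉ Icc l r ×ˢ Icc p q := by
  obtain ⟨ε₀, hε₀, hε₀'⟩ := (hK.inter_right
    (isClosed_Icc.prod isClosed_Icc : IsClosed (Icc l r ×ˢ Icc p q))).exists_pos_forall_le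
    (f := fun z => min (z.1 - l) (min (z.2 - p) (min (q - z.2)
      (max (r - z.1) (min (z.2 - s) (t - z.2)))))) (by fun_prop) (by
    rintro ⟨x, y⟩ ⟨hz, ⟨h1, h2⟩, h3, h4⟩
    simp only at h1 h2 h3 h4
    simp only [lt_min_iff, lt_max_iff, sub_pos]
    refine ⟨h1.lt_of_ne ?_, h3.lt_of_ne ?_, h4.lt_of_ne ?_, ?_⟩
    · rintro rfl; exact hl y h3 h4 hz
    · rintro rfl; exact hp x h1 h2 hz
    · rintro rfl; exact hq x h1 h2 hz
    · by_contra! hcon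
      obtain rfl : x = r := le_antisymm h2 hcon.1
      by_cases hy : s < y
      · exact ht y (hcon.2 hy) h4 hz
      · exact hs y h3 (not_lt.1 hy) hz)
  obtain ⟨ε, hε, hεle, hεst, hεlr⟩ : ∃ ε > 0, ε ≤ ε₀ ∧ ε < (t - s) / 2 ∧ ε < r - l := by
    refine ⟨min ε₀ (min ((t - s) / 4) ((r - l) / 2)), ?_, min_le_left _ _, ?_, ?_⟩
    · refine lt_min hε₀ (lt_min ?_ ?_) <;> linarith
    · have := (min_le_right ε₀ _).trans (min_le_left ((t - s) / 4) ((r - l) / 2)); linarith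
    · have := (min_le_right ε₀ _).trans (min_le_right ((t - s) / 4) ((r - l) / 2)); linarith
  have key : ∀ z ∈ K, z ∈ Icc l r ×ˢ Icc p q → l + ε ≤ z.1 ∧ p + ε ≤ z.2 ∧ z.2 ≤ q - ε ∧
      (z.1 ≤ r - ε ∨ (s + ε ≤ z.2 ∧ z.2 ≤ t - ε)) := by
    intro z hz hz'
    have := hεle.trans (hε₀' z ⟨hz, hz'⟩)
    simp only [le_min_iff, le_max_iff] at this
    obtain ⟨h1, h2, h3, h4⟩ := this
    refine ⟨by linarith, by linarith, by linarith, h4.imp (fun h => by linarith)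
      fun h => ⟨by linarith, by linarith⟩⟩
  clear hε₀'
  obtain ⟨U, U1, U2, U3, U4, U5⟩ := exists_homeomorph_push_up (a := p) (b := p + ε) (b' := s + ε)
    (c := t - ε) (u := l) (u' := l + ε) (v' := r - ε) (v := r) (by linarith) (by linarith)
    (by linarith) (by linarith) (by linarith)
  obtain ⟨D, D1, D2, D3, D4, D5⟩ := exists_homeomorph_push_down (a := q) (b := q - ε)
    (b' := t - ε) (c := s + ε) (u := l) (u' := l + ε) (v' := r - ε) (v := r) (by linarith)
    (by linarith) (by linarith) (by linarith) (by linarith)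
  obtain ⟨R, R1, R2, R3, R4, R5⟩ := exists_homeomorph_push (a := l) (b := l + ε)
    (b' := (r + w) / 2) (c := w) (u := s) (u' := s + ε) (v' := t - ε) (v := t) (by linarith)
    (by linarith) (by linarith) (by linarith) (by linarith)
  have hUD : ∀ z, z ∉ Icc l r ×ˢ Icc p q → D (U z) = z := by
    intro z hz
    have : z.2 ≤ p ∨ q ≤ z.2 ∨ z.1 ≤ l ∨ r ≤ z.1 := by
      by_contra! h
      exact hz ⟨⟨h.2.2.1.le, h.2.2.2.le⟩, h.1.le, h.2.1.le⟩
    rw [U3, D3]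
    · rcases this with h | h | h | h
      · exact Or.inr (Or.inl (by linarith))
      · exact Or.inl h
      · exact Or.inr (Or.inr (Or.inl h))
      · exact Or.inr (Or.inr (Or.inr h))
    · rcases this with h | h | h | h
      · exact Or.inl h
      · exact Or.inr (Or.inl (by linarith))
      · exact Or.inr (Or.inr (Or.inl h))
      · exact Or.inr (Or.inr (Or.inr h))
  refine ⟨(U.trans D).trans R, fun z hz hz' => ?_, fun z hz => ?_⟩
  · change R (D (U z)) = z
    rw [hUD z hz]
    apply R3
    by_contra! h
    by_cases hr : z.1 ≤ r
    · exact hz ⟨⟨h.1.le, hr⟩, by linarith, by linarith⟩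
    · exact hz' ⟨⟨(not_le.1 hr).le, h.2.1.le⟩, h.2.2⟩
  · change R (D (U z)) ∉ _
    by_cases hb : z ∈ Icc l r ×ˢ Icc p q
    · obtain ⟨k1, k2, k3, k4⟩ := key z hz hb
      have e1 : (D (U z)).1 = z.1 := by rw [D1, U1]
      have e2 : s + ε ≤ (D (U z)).2 ∧ (D (U z)).2 ≤ t - ε := by
        rcases k4 with k4 | ⟨k4, k5⟩
        · refine ⟨D4 _ (U5 z k2 k1 k4), D5 _ ?_ (by rwa [U1]) (by rwa [U1])⟩
          by_cases h : z.2 ≤ t - ε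
          · have := U4 z h; linarith
          · rw [U3 z (Or.inr (Or.inl (not_le.1 h).le))]; exact k3
        · exact ⟨D4 _ (k4.trans (U2 z)), (D2 _).trans (U4 z k5)⟩
      have := R5 (D (U z)) (by rw [e1]; exact k1) e2.1 e2.2
      intro hcon
      have := hcon.1.2
      linarith
    · rw [hUD z hb]
      intro hcon
      by_cases hf : z.1 ≤ l ∨ w ≤ z.1 ∨ z.2 ≤ s ∨ t ≤ z.2
      · rw [R3 z hf] at hcon; exact hb hcon
      · push Not at hf
        have h1 : z.1 ≤ r := (R2 z).trans hcon.1.2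
        exact hb ⟨⟨hf.1.le, h1⟩, by linarith, by linarith⟩

/-- The median of three strictly increasing affine maps bends `[m, m']` so that `g` goes to `b`. -/
theorem exists_homeomorph_of_graph {γ : ℝ → ℝ} (hγ : Continuous γ) {b m m' : ℝ} (hb : m < b)
    (hb' : b < m') (hm : ∀ x, m < γ x) (hm' : ∀ x, γ x < m') :
    ∃ h : ℝ × ℝ ≃ₜ ℝ × ℝ, (∀ z, z.2 ≤ m ∨ m' ≤ z.2 ∨ γ z.1 = b → h z = z) ∧
      (∀ z, z.2 < γ z.1 → (h z).2 < b) ∧ ∀ z, γ z.1 < z.2 → b < (h z).2 := by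
  let s : ℝ → ℝ := fun x => (b - m) / (γ x - m)
  let t : ℝ → ℝ := fun x => (m' - b) / (m' - γ x)
  have s0 : ∀ x, 0 < s x := fun x => div_pos (by linarith) (by linarith [hm x])
  have t0 : ∀ x, 0 < t x := fun x => div_pos (by linarith) (by linarith [hm' x])
  have s1 : ∀ x, s x * (γ x - m) = b - m := fun x => div_mul_cancel₀ _ (by linarith [hm x])
  have t1 : ∀ x, t x * (m' - γ x) = m' - b := fun x => div_mul_cancel₀ _ (by linarith [hm' x])
  have sc : Continuous s := continuous_const.div (by fun_prop) fun x => by linarith [hm x]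
  have tc : Continuous t := continuous_const.div (by fun_prop) fun x => by linarith [hm' x]
  let L : ℝ → ℝ → ℝ := fun y x => m + s x * (y - m)
  let R : ℝ → ℝ → ℝ := fun y x => m' - t x * (m' - y)
  let f : ℝ → ℝ → ℝ := fun y x => max (min (L y x) (R y x)) (min (max (L y x) (R y x)) y)
  have fmono : ∀ x, StrictMono fun y => f y x := by
    intro x y y' h
    have hL : L y x < L y' x := by have := s0 x; simp only [L]; nlinarith
    have hR : R y x < R y' x := by have := t0 x; simp only [R]; nlinarith
    exact max_lt_max (min_lt_min hL hR) (min_lt_min (max_lt_max hL hR) h)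
  have fmid : ∀ y x, (L y x ≤ y ∧ y ≤ R y x ∨ R y x ≤ y ∧ y ≤ L y x) → f y x = y := by
    intro y x h
    simp only [f]
    rcases h with ⟨h, h'⟩ | ⟨h, h'⟩
    · rw [min_eq_left (h.trans h'), max_eq_right (h.trans h'), min_eq_right h', max_eq_right h]
    · rw [min_eq_right (h.trans h'), max_eq_left (h.trans h'), min_eq_right h', max_eq_right h]
  have fout : ∀ y x, y ≤ m ∨ m' ≤ y → f y x = y := by
    intro y x h
    apply fmid
    have e1 : L y x - y = (s x - 1) * (y - m) := by simp only [L]; ring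
    have e2 : R y x - y = (1 - t x) * (m' - y) := by simp only [R]; ring
    have hs := s1 x
    have ht := t1 x
    have := hm x
    have := hm' x
    by_cases hg : γ x ≤ b
    · have a1 : 1 ≤ s x := by by_contra! h; nlinarith
      have a2 : t x ≤ 1 := by by_contra! h; nlinarith
      rcases h with h | h
      · left; constructor <;> nlinarith
      · right; constructor <;> nlinarith
    · have a1 : s x ≤ 1 := by by_contra! h; nlinarith
      have a2 : 1 ≤ t x := by by_contra! h; nlinarith
      rcases h with h | h
      · right; constructor <;> nlinarith
      · left; constructor <;> nlinarith
  have fγ : ∀ x, f (γ x) x = b := by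
    intro x
    have h1 : L (γ x) x = b := by simp only [L, s1]; ring
    have h2 : R (γ x) x = b := by simp only [R, t1]; ring
    simp [f, h1, h2]
  have fb : ∀ y x, γ x = b → f y x = y := by
    intro y x h
    have h1 : s x = 1 := by simp only [s, h]; exact div_self (by linarith)
    have h2 : t x = 1 := by simp only [t, h]; exact div_self (by linarith)
    apply fmid
    simp [L, R, h1, h2]
  obtain ⟨h, hh⟩ := exists_homeomorph_of_fiberwise (f := f) (by fun_prop) fmono (C := m' - m) (by
    intro y x
    by_cases hy : y ≤ m ∨ m' ≤ y
    · rw [fout y x hy]; simp; linarith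
    · push Not at hy
      have h1 := fmono x hy.1
      have h2 := fmono x hy.2
      simp only [fout m x (Or.inl le_rfl), fout m' x (Or.inr le_rfl)] at h1 h2
      rw [abs_le]; constructor <;> linarith)
  let φ := Homeomorph.prodComm ℝ ℝ
  have e : ∀ z, φ.trans (h.trans φ.symm) z = (z.1, f z.2 z.1) := by
    intro z
    change (h z.swap).swap = _
    rw [hh]; rfl
  refine ⟨φ.trans (h.trans φ.symm), fun z hz => ?_, fun z hz => ?_, fun z hz => ?_⟩ <;> rw [e]
  · rcases hz with hz | hz | hz
    · rw [fout _ _ (Or.inl hz)]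
    · rw [fout _ _ (Or.inr hz)]
    · rw [fb _ _ hz]
  · rw [← fγ z.1]; exact fmono _ hz
  · rw [← fγ z.1]; exact fmono _ hz

theorem exists_homeomorph_separating {A B : Set (ℝ × ℝ)} (hA : IsCompact A) (hB : IsCompact B)
    {l r m m' b : ℝ} (hAx : ∀ z ∈ A, l < z.1 ∧ z.1 < r) (hBx : ∀ z ∈ B, l < z.1 ∧ z.1 < r)
    (hAm : ∀ z ∈ A, z.2 < m') (hBm : ∀ z ∈ B, m < z.2)
    (hAB : ∀ x y y', (x, y) ∈ A → (x, y') ∈ B → y < y') (hb : m < b) (hb' : b < m') :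
    ∃ h : ℝ × ℝ ≃ₜ ℝ × ℝ, (∀ z, z ∉ Icc l r ×ˢ Icc m m' → h z = z) ∧
      (∀ z ∈ A, (h z).2 < b) ∧ ∀ z ∈ B, b < (h z).2 := by
  let t : ℝ → Set ℝ := fun x => {y | m < y ∧ y < m' ∧ (∀ y', (x, y') ∈ A → y' < y) ∧
    (∀ y', (x, y') ∈ B → y < y') ∧ (x ≤ l ∨ r ≤ x → y = b)}
  obtain ⟨γ, hγ⟩ := exists_continuous_forall_mem_convex_of_local_const (t := t) (by
    intro x
    apply Set.OrdConnected.convex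
    refine ⟨?_⟩
    rintro y ⟨h1, h2, h3, h4, h5⟩ y' ⟨h1', h2', h3', h4', h5'⟩ w ⟨hw, hw'⟩
    refine ⟨h1.trans_le hw, hw'.trans_lt h2', fun u hu => (h3 u hu).trans_le hw,
      fun u hu => hw'.trans_lt (h4' u hu), fun hx => ?_⟩
    have := h5 hx
    have := h5' hx
    linarith) (by
    intro x
    obtain ⟨y, hm, hm', h1, h2, h3⟩ : (t x).Nonempty := by
      by_cases hx : x ≤ l ∨ r ≤ x
      · refine ⟨b, hb, hb', fun y' hy' => ?_, fun y' hy' => ?_, fun _ => rfl⟩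
        · have := hAx _ hy'; rcases hx with hx | hx <;> simp only at this <;> linarith
        · have := hBx _ hy'; rcases hx with hx | hx <;> simp only at this <;> linarith
      · have hsl : ∀ {S : Set (ℝ × ℝ)}, IsCompact S → IsCompact ((fun y => (x, y)) ⁻¹' S) := by
          intro S hS
          exact (Topology.IsClosedEmbedding.isCompact_preimage
            (Topology.IsClosedEmbedding.of_continuous_injective_isClosedMap (by fun_prop)
              (Prod.mk_right_injective x) (isClosedMap_prodMk_left x)) hS)
        obtain ⟨α, hα, hα'⟩ := ((hsl hA).insert m).exists_isGreatest (insert_nonempty _ _)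
        obtain ⟨β, hβ, hβ'⟩ := ((hsl hB).insert m').exists_isLeast (insert_nonempty _ _)
        have hαβ : α < β := by
          rcases hα with rfl | hα <;> rcases hβ with rfl | hβ
          · linarith
          · exact hBm _ hβ
          · exact hAm _ hα
          · exact hAB _ _ _ hα hβ
        have h1 : m ≤ α := hα' (mem_insert _ _)
        have h2 : β ≤ m' := hβ' (mem_insert _ _)
        refine ⟨(α + β) / 2, by linarith, by linarith, fun y' hy' => ?_, fun y' hy' => ?_,
          fun h => absurd h hx⟩
        · have : y' ≤ α := hα' (mem_insert_of_mem _ hy'); linarith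
        · have : β ≤ y' := hβ' (mem_insert_of_mem _ hy'); linarith
    refine ⟨y, ?_⟩
    have e1 : ∀ᶠ x' in 𝓝 x, ∀ y', (x', y') ∈ A → y' < y := by
      have hc : IsClosed (Prod.fst '' (A ∩ {z | y ≤ z.2})) := ((hA.inter_right
        (isClosed_le continuous_const continuous_snd)).image continuous_fst).isClosed
      have hx : x ∈ (Prod.fst '' (A ∩ {z : ℝ × ℝ | y ≤ z.2}))ᶜ := by
        rintro ⟨⟨x', y'⟩, ⟨hz, hz'⟩, rfl⟩
        exact absurd (h1 y' hz) (not_lt.2 hz')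
      filter_upwards [hc.isOpen_compl.mem_nhds hx] with x' hx' y' hy'
      by_contra! hcon
      exact hx' ⟨_, ⟨hy', hcon⟩, rfl⟩
    have e2 : ∀ᶠ x' in 𝓝 x, ∀ y', (x', y') ∈ B → y < y' := by
      have hc : IsClosed (Prod.fst '' (B ∩ {z | z.2 ≤ y})) := ((hB.inter_right
        (isClosed_le continuous_snd continuous_const)).image continuous_fst).isClosed
      have hx : x ∈ (Prod.fst '' (B ∩ {z : ℝ × ℝ | z.2 ≤ y}))ᶜ := by
        rintro ⟨⟨x', y'⟩, ⟨hz, hz'⟩, rfl⟩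
        exact absurd (h2 y' hz) (not_lt.2 hz')
      filter_upwards [hc.isOpen_compl.mem_nhds hx] with x' hx' y' hy'
      by_contra! hcon
      exact hx' ⟨_, ⟨hy', hcon⟩, rfl⟩
    have e3 : ∀ᶠ x' in 𝓝 x, x' ≤ l ∨ r ≤ x' → y = b := by
      by_cases hx : x ≤ l ∨ r ≤ x
      · exact Eventually.of_forall fun _ _ => h3 hx
      · push Not at hx
        filter_upwards [Ioo_mem_nhds hx.1 hx.2] with x' hx' h
        rcases h with h | h
        · exact absurd hx'.1 (not_lt.2 h)
        · exact absurd hx'.2 (not_lt.2 h)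
    filter_upwards [e1, e2, e3] with x' h1 h2 h3
    exact ⟨hm, hm', h1, h2, h3⟩)
  obtain ⟨h, h1, h2, h3⟩ := exists_homeomorph_of_graph γ.continuous hb hb' (fun x => (hγ x).1)
    fun x => (hγ x).2.1
  refine ⟨h, fun z hz => h1 z ?_, fun z hz => h2 z ((hγ z.1).2.2.1 _ hz),
    fun z hz => h3 z ((hγ z.1).2.2.2.1 _ hz)⟩
  by_contra! hcon
  refine hz ⟨?_, hcon.1.le, hcon.2.1.le⟩
  by_contra hx
  refine hcon.2.2 ((hγ z.1).2.2.2.2 ?_)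
  by_contra! h
  exact hx ⟨h.1.le, h.2.le⟩

/-- A two-colouring of the unit cells of the integer grid (`false` below, `true` above) whose
colour changes inside the box `[0, n] × [0, m]` happen along edges missing `K`. -/
structure IsGridColoring (K : Set (ℝ × ℝ)) (n m b : ℤ) (c : ℤ → ℤ → Bool) : Prop where
  low : ∀ i j, j ≤ 0 → c i j = false
  high : ∀ i j, m ≤ j + 1 → c i j = true
  ends : ∀ i j, (i ≤ 0 ∨ n ≤ i + 1) → c i j = decide (b ≤ j)
  vert : ∀ i j, c i j ≠ c (i + 1) j → ∀ y : ℝ, j ≤ y → y ≤ j + 1 → ((i : ℝ) + 1, y) ∉ K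
  horiz : ∀ i j, c i j ≠ c i (j + 1) → ∀ x : ℝ, i ≤ x → x ≤ i + 1 → (x, (j : ℝ) + 1) ∉ K

/-- In column `i` the cells of rows `[p, q)` form a maximal run coloured `!o`, and all their left
neighbours are coloured `o`. -/
def IsLeftRun (c : ℤ → ℤ → Bool) (i p q : ℤ) (o : Bool) : Prop :=
  p < q ∧ c i (p - 1) = o ∧ c i q = o ∧ ∀ j, p ≤ j → j < q → c i j = !o ∧ c (i - 1) j = o

/-- Recolour the cells of rows `[p, q)` in column `i` with `o`. -/
def recolor (c : ℤ → ℤ → Bool) (i p q : ℤ) (o : Bool) (i' j : ℤ) : Bool :=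
  if i' = i ∧ p ≤ j ∧ j < q then o else c i' j

theorem exists_run_around {f : ℤ → Bool} {o : Bool} {j₁ j₂ j₃ : ℤ} (h₁₂ : j₁ < j₂) (h₂₃ : j₂ < j₃)
    (h₁ : f j₁ = !o) (h₂ : f j₂ = o) (h₃ : f j₃ = !o) :
    ∃ p q, j₁ < p ∧ p ≤ j₂ ∧ j₂ < q ∧ q ≤ j₃ ∧ f (p - 1) = !o ∧ f q = !o ∧
      ∀ j, p ≤ j → j < q → f j = o := by
  obtain ⟨p, ⟨hp, hp'⟩, hpm⟩ := Int.exists_greatest_of_bdd (P := fun j => j ≤ j₂ ∧ f j = !o)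
    ⟨j₂, fun z hz => hz.1⟩ ⟨j₁, h₁₂.le, h₁⟩
  obtain ⟨q, ⟨hq, hq'⟩, hqm⟩ := Int.exists_least_of_bdd (P := fun j => j₂ ≤ j ∧ f j = !o)
    ⟨j₂, fun z hz => hz.1⟩ ⟨j₃, h₂₃.le, h₃⟩
  have e1 := hpm j₁ ⟨h₁₂.le, h₁⟩
  have e2 := hqm j₃ ⟨h₂₃.le, h₃⟩
  have e3 : p ≠ j₂ := by rintro rfl; simp [h₂] at hp'
  have e4 : q ≠ j₂ := by rintro rfl; simp [h₂] at hq'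
  refine ⟨p + 1, q, by omega, by omega, by omega, e2, by simpa using hp', hq', fun j hj hj' => ?_⟩
  by_contra hne
  have hne' : f j = !o := by revert hne; cases f j <;> cases o <;> simp
  rcases le_total j j₂ with h | h
  · have := hpm j ⟨h, hne'⟩; omega
  · have := hqm j ⟨h, hne'⟩; omega

theorem exists_isLeftRun_of_not_mono {c : ℤ → ℤ → Bool} {i m : ℤ}
    (hlow : ∀ j, j ≤ 0 → c i j = false) (hhigh : ∀ j, m ≤ j + 1 → c i j = true)
    (hmono : ∀ j, c (i - 1) j = true → c (i - 1) (j + 1) = true)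
    (h : ¬ ∀ j, c i j = true → c i (j + 1) = true) : ∃ p q o, IsLeftRun c i p q o := by
  push Not at h
  obtain ⟨j₀, h₀, h₁⟩ := h
  have h₁ : c i (j₀ + 1) = false := by simpa using h₁
  have hm : ∀ j k, j ≤ k → c (i - 1) j = true → c (i - 1) k = true := by
    intro j k hjk hj
    induction k, hjk using Int.leInduction with
    | base => exact hj
    | succ k _ ih => exact hmono k ih
  have hj₀ : 0 < j₀ := by
    by_contra hh
    simp [hlow j₀ (by omega)] at h₀
  have hj₁ : j₀ + 2 < m := by
    by_contra hh
    simp [hhigh (j₀ + 1) (by omega)] at h₁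
  cases h2 : c (i - 1) j₀ with
  | false =>
    obtain ⟨p, q, hp, hp', hq, hq', hp1, hq1, hr⟩ :=
      exists_run_around (f := c i) (o := true) hj₀ (lt_add_one j₀) (hlow 0 le_rfl) h₀ h₁
    refine ⟨p, q, false, by omega, hp1, hq1, fun j hj hjq => ⟨hr j hj hjq, ?_⟩⟩
    by_contra hh
    have := hm j j₀ (by omega) (by simpa using hh)
    simp [this] at h2
  | true =>
    obtain ⟨p, q, hp, hp', hq, hq', hp1, hq1, hr⟩ :=
      exists_run_around (f := c i) (o := false) (lt_add_one j₀)
        (show j₀ + 1 < m by omega) h₀ h₁ (hhigh m (by omega))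
    exact ⟨p, q, true, by omega, hp1, hq1, fun j hj hjq => ⟨hr j hj hjq, hm _ _ (by omega) h2⟩⟩

namespace IsGridColoring

variable {K : Set (ℝ × ℝ)} {n m b : ℤ} {c : ℤ → ℤ → Bool}

theorem mono_of_forall_not_isLeftRun (hc : IsGridColoring K n m b c)
    (h : ∀ i p q o, ¬ IsLeftRun c i p q o) (i : ℤ) (j : ℤ) (hj : c i j = true) :
    c i (j + 1) = true := by
  have key : ∀ i, 0 ≤ i → ∀ j, c i j = true → c i (j + 1) = true := by
    intro i hi
    induction i, hi using Int.leInduction with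
    | base =>
      intro j hj
      rw [hc.ends _ _ (by simp)] at hj ⊢
      simp at hj ⊢; omega
    | succ k _ ih =>
      by_contra hne
      obtain ⟨p, q, o, hpq⟩ := exists_isLeftRun_of_not_mono (hc.low (k + 1)) (hc.high (k + 1))
        (by simpa using ih) hne
      exact h _ _ _ _ hpq
  rcases le_total 0 i with hi | hi
  · exact key i hi j hj
  · rw [hc.ends _ _ (by simp [hi])] at hj ⊢
    simp at hj ⊢; omega

theorem isLeftRun_bounds (hc : IsGridColoring K n m b c) {i p q : ℤ} {o : Bool}
    (h : IsLeftRun c i p q o) : 0 < i ∧ i + 1 < n ∧ 0 < p ∧ q < m := by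
  obtain ⟨hpq, h1, h2, h3⟩ := h
  have h4 := (h3 p le_rfl hpq).1
  have h5 := (h3 (q - 1) (by omega) (by omega)).1
  have hi : ¬ (i ≤ 0 ∨ n ≤ i + 1) := by
    intro hi
    rw [hc.ends i _ hi] at h1 h2 h4
    revert h1 h2 h4
    cases o <;> simp <;> omega
  refine ⟨by omega, by omega, ?_, ?_⟩
  · by_contra hp
    rw [hc.low i (p - 1) (by omega)] at h1
    rw [hc.low i p (by omega)] at h4
    subst h1; simp at h4
  · by_contra hq
    rw [hc.high i q (by omega)] at h2
    rw [hc.high i (q - 1) (by omega)] at h5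
    subst h2; simp at h5

theorem low_recolor (hc : IsGridColoring K n m b c) {i p q : ℤ} {o : Bool}
    (h : IsLeftRun c i p q o) (i' j : ℤ) (hj : j ≤ 0) : recolor c i p q o i' j = false := by
  have := hc.isLeftRun_bounds h
  rw [recolor, if_neg (by omega), hc.low _ _ hj]

theorem high_recolor (hc : IsGridColoring K n m b c) {i p q : ℤ} {o : Bool}
    (h : IsLeftRun c i p q o) (i' j : ℤ) (hj : m ≤ j + 1) : recolor c i p q o i' j = true := by
  have := hc.isLeftRun_bounds h
  rw [recolor, if_neg (by omega), hc.high _ _ hj]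

theorem ends_recolor (hc : IsGridColoring K n m b c) {i p q : ℤ} {o : Bool}
    (h : IsLeftRun c i p q o) (i' j : ℤ) (hi : i' ≤ 0 ∨ n ≤ i' + 1) :
    recolor c i p q o i' j = decide (b ≤ j) := by
  have := hc.isLeftRun_bounds h
  rw [recolor, if_neg (by omega), hc.ends _ _ hi]

end IsGridColoring

theorem IsLeftRun.recolor_ne {c : ℤ → ℤ → Bool} {i p q : ℤ} {o : Bool}
    (h : IsLeftRun c i p q o) {i' j : ℤ}
    (hne : recolor c i p q o i' j ≠ recolor c i p q o i' (j + 1)) :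
    c i' j ≠ c i' (j + 1) ∧ ¬ (i' = i ∧ p ≤ j + 1 ∧ j < q) := by
  obtain ⟨hpq, h1, h2, h3⟩ := h
  have key : ¬ (i' = i ∧ p ≤ j + 1 ∧ j < q) := by
    rintro ⟨rfl, hj, hj'⟩
    apply hne
    have a1 : recolor c i' p q o i' j = o := by
      unfold recolor
      split_ifs with hh
      · rfl
      · have : j = p - 1 := by omega
        rw [this, h1]
    have a2 : recolor c i' p q o i' (j + 1) = o := by
      unfold recolor
      split_ifs with hh
      · rfl
      · have : j + 1 = q := by omega
        rw [this, h2]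
    rw [a1, a2]
  refine ⟨?_, key⟩
  rwa [recolor, recolor, if_neg (by omega), if_neg (by omega)] at hne

theorem card_recolor_lt {c : ℤ → ℤ → Bool} {i p q n m : ℤ} {o : Bool} (h : IsLeftRun c i p q o)
    (hb : 0 < i ∧ i + 1 < n ∧ 0 < p ∧ q < m) :
    ((Finset.Icc 0 n ×ˢ Finset.Icc 0 m).filter
      fun z => recolor c i p q o z.1 z.2 ≠ recolor c i p q o z.1 (z.2 + 1)).card <
    ((Finset.Icc 0 n ×ˢ Finset.Icc 0 m).filter fun z => c z.1 z.2 ≠ c z.1 (z.2 + 1)).card := by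
  apply Finset.card_lt_card
  rw [Finset.ssubset_iff_of_subset]
  · refine ⟨(i, p - 1), ?_, ?_⟩
    · have := h.1
      simp only [Finset.mem_filter, Finset.mem_product, Finset.mem_Icc, sub_add_cancel]
      refine ⟨by omega, ?_⟩
      rw [h.2.1, (h.2.2.2 p le_rfl h.1).1]
      simp
    · intro hm
      have h1 := (h.recolor_ne (Finset.mem_filter.1 hm).2).2
      have := h.1
      simp only [true_and, sub_add_cancel, le_refl, not_lt] at h1
      omega
  · intro z hz
    rw [Finset.mem_filter] at hz ⊢
    exact ⟨hz.1, (h.recolor_ne hz.2).1⟩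

theorem exists_int_cell {p q : ℤ} (hpq : p < q) {y : ℝ} (hp : (p : ℝ) ≤ y) (hq : y ≤ q) :
    ∃ j : ℤ, p ≤ j ∧ j < q ∧ (j : ℝ) ≤ y ∧ y ≤ j + 1 := by
  rcases hq.eq_or_lt with rfl | hq
  · exact ⟨q - 1, by omega, by omega, by push_cast; linarith, by push_cast; linarith⟩
  · exact ⟨⌊y⌋, Int.le_floor.2 hp, Int.floor_lt.2 hq, Int.floor_le y, (Int.lt_floor_add_one y).le⟩

theorem Homeomorph.mem_of_forall_notMem {X : Type*} [TopologicalSpace X] (h : X ≃ₜ X) {S T : Set X}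
    (hS : ∀ z, z ∉ S → h z = z) (hST : S ⊆ T) {z : X} (hz : z ∈ T) : h z ∈ T := by
  by_contra hh
  have h1 := hS (h z) fun h' => hh (hST h')
  rw [h.injective h1] at hh
  exact hh hz

namespace IsGridColoring

variable {K : Set (ℝ × ℝ)} {n m b : ℤ} {c : ℤ → ℤ → Bool}

theorem recolor_of_forall_right (hc : IsGridColoring K n m b c) {i p q : ℤ} {o : Bool}
    (h : IsLeftRun c i p q o) (hr : ∀ j, p ≤ j → j < q → c (i + 1) j = o) :
    IsGridColoring K n m b (recolor c i p q o) where
  low := hc.low_recolor h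
  high := hc.high_recolor h
  ends := hc.ends_recolor h
  horiz i' j hne := hc.horiz i' j (h.recolor_ne hne).1
  vert i' j hne := by
    apply hc.vert i' j
    intro heq
    apply hne
    unfold recolor
    split_ifs with h1 h2 h2
    · rfl
    · rw [h1.1, hr j h1.2.1 h1.2.2]
    · have : i' = i - 1 := by omega
      rw [this, (h.2.2.2 j h2.2.1 h2.2.2).2]
    · exact heq

theorem exists_evict_recolor (hc : IsGridColoring K n m b c) (hK : IsCompact K) {i p q s t : ℤ}
    {o : Bool} (h : IsLeftRun c i p q o) (hps : p ≤ s) (hst : s < t) (htq : t ≤ q)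
    (hr : ∀ j, p ≤ j → j < q → (c (i + 1) j = !o ↔ s ≤ j ∧ j < t)) :
    ∃ f : ℝ × ℝ ≃ₜ ℝ × ℝ,
      (∀ z, z ∉ Ioo (0 : ℝ) n ×ˢ Icc (0 : ℝ) m → f z = z) ∧
      IsGridColoring (f '' K) n m b (recolor c i p q o) := by
  have hbd := hc.isLeftRun_bounds h
  have hpq := h.1
  have hrun := h.2.2.2
  have hbot : ∀ x : ℝ, i ≤ x → x ≤ i + 1 → (x, (p : ℝ)) ∉ K := by
    intro x h1 h2
    have := hc.horiz i (p - 1) (by rw [h.2.1, sub_add_cancel, (hrun p le_rfl hpq).1]; simp) x h1 h2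
    simpa using this
  have htop : ∀ x : ℝ, i ≤ x → x ≤ i + 1 → (x, (q : ℝ)) ∉ K := by
    intro x h1 h2
    have := hc.horiz i (q - 1)
      (by rw [sub_add_cancel, h.2.2.1, (hrun (q - 1) (by omega) (by omega)).1]; simp) x h1 h2
    simpa using this
  have hside : ∀ p' q' : ℤ, p ≤ p' → p' < q' → q' ≤ q → (∀ j, p' ≤ j → j < q' → c (i + 1) j = o) →
      ∀ y : ℝ, p' ≤ y → y ≤ q' → ((i : ℝ) + 1, y) ∉ K := by
    intro p' q' h1 h2 h3 h4 y hy hy'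
    obtain ⟨j, hj, hj', hjy, hjy'⟩ := exists_int_cell h2 hy hy'
    refine hc.vert i j ?_ y hjy hjy'
    rw [(hrun j (by omega) (by omega)).1, h4 j hj hj']
    simp
  have hro : ∀ j, p ≤ j → j < q → ¬ (s ≤ j ∧ j < t) → c (i + 1) j = o := by
    intro j h1 h2 h3
    have := mt (hr j h1 h2).1 h3
    revert this
    cases c (i + 1) j <;> cases o <;> simp
  obtain ⟨f, hf, hf'⟩ := exists_homeomorph_evict hK (l := i) (r := i + 1) (w := i + 3 / 2) (p := p)
    (q := q) (s := s) (t := t) (by linarith) (by linarith) (by exact_mod_cast hps)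
    (by exact_mod_cast hst) (by exact_mod_cast htq)
    (by
      intro y hy hy'
      obtain ⟨j, hj, hj', hjy, hjy'⟩ := exists_int_cell hpq hy hy'
      have := hc.vert (i - 1) j (by rw [sub_add_cancel, (hrun j hj hj').1, (hrun j hj hj').2]; simp)
        y hjy hjy'
      simpa using this)
    hbot htop
    (by
      intro y hy hy'
      rcases hps.eq_or_lt with rfl | hps'
      · rw [le_antisymm hy' hy]
        exact hbot _ (by linarith) le_rfl
      · exact hside p s le_rfl hps' (by omega) (fun j h1 h2 => hro j h1 (by omega) (by omega)) y
          hy hy')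
    (by
      intro y hy hy'
      rcases htq.eq_or_lt with rfl | htq'
      · rw [le_antisymm hy' hy]
        exact htop _ (by linarith) le_rfl
      · exact hside t q (by omega) htq' le_rfl (fun j h1 h2 => hro j (by omega) (by omega) (by omega))
          y hy hy')
  have hnot : ∀ z, z ∉ K → z ∈ f '' K → z ∉ Icc (i : ℝ) (i + 1) ×ˢ Icc (p : ℝ) q ∧
      z ∈ Icc (i + 1 : ℝ) (i + 3 / 2) ×ˢ Ioo (s : ℝ) t := by
    rintro z hzK ⟨k, hk, rfl⟩
    refine ⟨hf' k hk, ?_⟩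
    by_contra hh
    have := hf _ (hf' k hk) hh
    rw [f.injective this] at hzK
    exact hzK hk
  refine ⟨f, fun z hz => hf z ?_ ?_, hc.low_recolor h, hc.high_recolor h, hc.ends_recolor h, ?_, ?_⟩
  · rintro ⟨⟨h1, h2⟩, h3, h4⟩
    apply hz
    have e1 : (0 : ℝ) < i := by exact_mod_cast hbd.1
    have e2 : ((i : ℝ) + 1) < n := by exact_mod_cast hbd.2.1
    have e3 : (0 : ℝ) < p := by exact_mod_cast hbd.2.2.1
    have e4 : (q : ℝ) < m := by exact_mod_cast hbd.2.2.2
    exact ⟨⟨by linarith, by linarith⟩, by linarith, by linarith⟩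
  · rintro ⟨⟨h1, h2⟩, h3, h4⟩
    apply hz
    have e1 : (0 : ℝ) < i := by exact_mod_cast hbd.1
    have e2 : ((i : ℝ) + 2) ≤ n := by
      have : i + 2 ≤ n := by omega
      exact_mod_cast this
    have e3 : (0 : ℝ) < p := by exact_mod_cast hbd.2.2.1
    have e4 : (q : ℝ) < m := by exact_mod_cast hbd.2.2.2
    have e5 : (p : ℝ) ≤ s := by exact_mod_cast hps
    have e6 : (t : ℝ) ≤ q := by exact_mod_cast htq
    exact ⟨⟨by linarith, by linarith⟩, by linarith, by linarith⟩
  · intro i' j hne y hy hy' hmem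
    have hbox : ∀ z ∈ f '' K, z ∉ Icc (i : ℝ) (i + 1) ×ˢ Icc (p : ℝ) q := by
      rintro _ ⟨k, hk, rfl⟩
      exact hf' k hk
    have hrow : p ≤ j → j < q → (p : ℝ) ≤ y ∧ y ≤ q := by
      intro h1 h2
      have e1 : (p : ℝ) ≤ j := by exact_mod_cast h1
      have e2 : (j : ℝ) + 1 ≤ q := by exact_mod_cast h2
      constructor <;> linarith
    by_cases h1 : i' = i ∧ p ≤ j ∧ j < q
    · obtain ⟨rfl, h1, h2⟩ := h1
      exact hbox _ hmem ⟨⟨by simp, le_rfl⟩, hrow h1 h2⟩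
    by_cases h2 : i' + 1 = i ∧ p ≤ j ∧ j < q
    · obtain ⟨rfl, h1, h2⟩ := h2
      exact hbox _ hmem ⟨⟨by simp, by simp⟩, hrow h1 h2⟩
    rw [recolor, recolor, if_neg h1, if_neg h2] at hne
    obtain ⟨-, ⟨h5, h6⟩, h7, h8⟩ := hnot _ (hc.vert i' j hne y hy hy') hmem
    simp only at h5 h6 h7 h8
    have e1 : i ≤ i' := by
      have : (i : ℝ) ≤ i' := by linarith
      exact_mod_cast this
    have e2 : i' < i + 1 := by
      have : (i' : ℝ) < i + 1 := by linarith
      exact_mod_cast this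
    have e3 : s < j + 1 := by
      have : (s : ℝ) < j + 1 := by linarith
      exact_mod_cast this
    have e4 : j < t := by
      have : (j : ℝ) < t := by linarith
      exact_mod_cast this
    omega
  · intro i' j hne x hx hx' hmem
    obtain ⟨hne', hrow⟩ := h.recolor_ne hne
    obtain ⟨hbox, ⟨h5, h6⟩, h7, h8⟩ := hnot _ (hc.horiz i' j hne' x hx hx') hmem
    simp only at h5 h6 h7 h8
    have e3 : s < j + 1 := by exact_mod_cast h7
    have e4 : j + 1 < t := by exact_mod_cast h8
    have e1 : i ≤ i' := by
      have : (i : ℝ) ≤ i' := by linarith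
      exact_mod_cast this
    have e2 : i' < i + 2 := by
      have : (i' : ℝ) < i + 2 := by linarith
      exact_mod_cast this
    have e5 : i' = i + 1 := by omega
    subst e5
    apply hne'
    rw [(hr j (by omega) (by omega)).2 (by omega), (hr (j + 1) (by omega) (by omega)).2 (by omega)]

theorem exists_isGridColoring_mono (hc : IsGridColoring K n m b c) (hK : IsCompact K) :
    ∃ (f : ℝ × ℝ ≃ₜ ℝ × ℝ) (c' : ℤ → ℤ → Bool),
      (∀ z, z ∉ Ioo (0 : ℝ) n ×ˢ Icc (0 : ℝ) m → f z = z) ∧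
      IsGridColoring (f '' K) n m b c' ∧ ∀ i j, c' i j = true → c' i (j + 1) = true := by
  induction hN : ((Finset.Icc 0 n ×ˢ Finset.Icc 0 m).filter
      fun z => c z.1 z.2 ≠ c z.1 (z.2 + 1)).card using Nat.strong_induction_on generalizing c K with
  | _ N ih =>
  by_cases hrun : ∃ i p q o, IsLeftRun c i p q o
  swap
  · push Not at hrun
    exact ⟨.refl _, c, fun z _ => rfl, by simpa using hc, hc.mono_of_forall_not_isLeftRun hrun⟩
  obtain ⟨i, ⟨p, q, o, h⟩, hmax⟩ := Int.exists_greatest_of_bdd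
    (P := fun i => ∃ p q o, IsLeftRun c i p q o)
    ⟨n, fun i ⟨p, q, o, h⟩ => by have := hc.isLeftRun_bounds h; omega⟩ hrun
  have hbd := hc.isLeftRun_bounds h
  have step : ∃ f : ℝ × ℝ ≃ₜ ℝ × ℝ,
      (∀ z, z ∉ Ioo (0 : ℝ) n ×ˢ Icc (0 : ℝ) m → f z = z) ∧
      IsGridColoring (f '' K) n m b (recolor c i p q o) := by
    by_cases hS : ∃ j, p ≤ j ∧ j < q ∧ c (i + 1) j = !o
    swap
    · push Not at hS
      refine ⟨.refl _, fun z _ => rfl, ?_⟩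
      simpa using hc.recolor_of_forall_right h fun j h1 h2 => by
        have := hS j h1 h2
        revert this
        cases c (i + 1) j <;> cases o <;> simp
    obtain ⟨s, ⟨hs1, hs2, hs3⟩, hsm⟩ := Int.exists_least_of_bdd ⟨p, fun z hz => hz.1⟩ hS
    obtain ⟨t, ⟨ht1, ht2, ht3⟩, htm⟩ := Int.exists_greatest_of_bdd ⟨q, fun z hz => hz.2.1.le⟩ hS
    have hst := htm s ⟨hs1, hs2, hs3⟩
    refine hc.exists_evict_recolor hK h hs1 (t := t + 1) (by omega) (by omega) fun j h1 h2 =>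
      ⟨fun h3 => ⟨hsm j ⟨h1, h2, h3⟩, ?_⟩, fun ⟨h3, h4⟩ => ?_⟩
    · have := htm j ⟨h1, h2, h3⟩
      omega
    by_contra h5
    have h6 : c (i + 1) j = o := by
      revert h5
      cases c (i + 1) j <;> cases o <;> simp
    have h7 : s ≠ j := by rintro rfl; exact h5 hs3
    have h8 : j ≠ t := by rintro rfl; exact h5 ht3
    obtain ⟨p', q', a1, a2, a3, a4, a5, a6, a7⟩ :=
      exists_run_around (f := c (i + 1)) (show s < j by omega) (show j < t by omega) hs3 h6 ht3
    have := hmax (i + 1) ⟨p', q', !o, by omega, a5, a6, fun k hk hk' =>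
      ⟨by rw [a7 k hk hk', Bool.not_not],
        by rw [add_sub_cancel_right, (h.2.2.2 k (by omega) (by omega)).1]⟩⟩
    omega
  obtain ⟨f, hf, hfc⟩ := step
  obtain ⟨g, c', hg, hgc, hc'⟩ := ih _ (hN ▸ card_recolor_lt h hbd) hfc (hK.image f.continuous) rfl
  refine ⟨f.trans g, c', fun z hz => ?_, ?_, hc'⟩
  · rw [Homeomorph.trans_apply, hf z hz, hg z hz]
  · have : f.trans g '' K = g '' (f '' K) := Set.image_comp g f K
    rwa [this]

end IsGridColoring

namespace IsGridColoring

variable {K : Set (ℝ × ℝ)} {n m b : ℤ} {c : ℤ → ℤ → Bool}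

theorem color_floor (hc : IsGridColoring K n m b c) {z : ℝ × ℝ} (hz : z ∈ K) {i j : ℤ}
    (hi : (i : ℝ) ≤ z.1) (hi' : z.1 ≤ i + 1) (hj : (j : ℝ) ≤ z.2) (hj' : z.2 ≤ j + 1) :
    c i j = c ⌊z.1⌋ ⌊z.2⌋ := by
  have h1 : c i j = c ⌊z.1⌋ j := by
    rcases hi'.eq_or_lt with h | h
    · have : ⌊z.1⌋ = i + 1 := by rw [h]; simp
      rw [this]
      by_contra hne
      exact hc.vert i j hne z.2 hj hj' (by rw [← h]; exact hz)
    · rw [Int.floor_eq_iff.2 ⟨hi, h⟩]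
  rw [h1]
  rcases hj'.eq_or_lt with h | h
  · have : ⌊z.2⌋ = j + 1 := by rw [h]; simp
    rw [this]
    by_contra hne
    exact hc.horiz _ j hne z.1 (Int.floor_le _) (Int.lt_floor_add_one _).le
      (by rw [← h]; exact hz)
  · rw [Int.floor_eq_iff.2 ⟨hj, h⟩]

theorem isCompact_color (hc : IsGridColoring K n m b c) (hK : IsCompact K)
    (hsub : K ⊆ Ioo (0 : ℝ) n ×ˢ Icc (0 : ℝ) m) (o : Bool) :
    IsCompact {z ∈ K | c ⌊z.1⌋ ⌊z.2⌋ = o} := by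
  have : {z ∈ K | c ⌊z.1⌋ ⌊z.2⌋ = o} = K ∩ ⋃ p ∈ (((Finset.Icc 0 n ×ˢ Finset.Icc 0 m).filter
      fun p => c p.1 p.2 = o : Finset (ℤ × ℤ)) : Set (ℤ × ℤ)),
      Icc (p.1 : ℝ) (p.1 + 1) ×ˢ Icc (p.2 : ℝ) (p.2 + 1) := by
    ext z
    simp only [mem_ofPred_eq, mem_inter_iff, mem_iUnion, exists_prop, Finset.coe_filter,
      Finset.mem_product, Finset.mem_Icc]
    refine and_congr_right fun hz => ⟨fun h => ?_, ?_⟩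
    · obtain ⟨⟨h1, h2⟩, h3, h4⟩ := hsub hz
      refine ⟨(⌊z.1⌋, ⌊z.2⌋), ⟨⟨⟨?_, ?_⟩, ?_, ?_⟩, h⟩, ⟨Int.floor_le _, (Int.lt_floor_add_one _).le⟩,
        Int.floor_le _, (Int.lt_floor_add_one _).le⟩
      · exact Int.floor_nonneg.2 h1.le
      · exact (Int.floor_lt.2 h2).le
      · exact Int.floor_nonneg.2 h3
      · exact_mod_cast (Int.floor_le _).trans h4
    · rintro ⟨p, ⟨-, h⟩, ⟨h1, h2⟩, h3, h4⟩
      rw [← hc.color_floor hz h1 h2 h3 h4, h]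
  rw [this]
  refine hK.inter_right (Set.Finite.isClosed_biUnion (Finset.finite_toSet _) fun p _ => ?_)
  exact isClosed_Icc.prod isClosed_Icc

theorem exists_homeomorph_avoid (hc : IsGridColoring K n m b c) (hK : IsCompact K)
    (hsub : K ⊆ Ioo (0 : ℝ) n ×ˢ Icc (0 : ℝ) m) (hb : 0 < b) (hbm : b < m) :
    ∃ f : ℝ × ℝ ≃ₜ ℝ × ℝ, (∀ z, z ∉ Icc (0 : ℝ) n ×ˢ Icc (0 : ℝ) m → f z = z) ∧
      ∀ z ∈ K, (f z).2 ≠ b := by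
  obtain ⟨f, c', hf, hc', hmono⟩ := hc.exists_isGridColoring_mono hK
  have hK' := hK.image f.continuous
  have hsub' : f '' K ⊆ Ioo (0 : ℝ) n ×ˢ Icc (0 : ℝ) m := by
    rintro _ ⟨k, hk, rfl⟩
    exact f.mem_of_forall_notMem hf Subset.rfl (hsub hk)
  have hm : ∀ i j k, j ≤ k → c' i j = true → c' i k = true := by
    intro i j k hjk hj
    induction k, hjk using Int.leInduction with
    | base => exact hj
    | succ k _ ih => exact hmono i k ih
  obtain ⟨g, hg, hgA, hgB⟩ := exists_homeomorph_separating
    (hc'.isCompact_color hK' hsub' false) (hc'.isCompact_color hK' hsub' true)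
    (l := 0) (r := n) (m := 0) (m' := m) (b := b)
    (fun z hz => (hsub' hz.1).1) (fun z hz => (hsub' hz.1).1)
    (by
      intro z hz
      by_contra hlt
      have : c' ⌊z.1⌋ (m - 1) = false := by
        rw [← hz.2]
        have h1 : z.2 = m := le_antisymm (hsub' hz.1).2.2 (not_lt.1 hlt)
        exact hc'.color_floor hz.1 (Int.floor_le _) (Int.lt_floor_add_one _).le
          (by push_cast; linarith) (by push_cast; linarith)
      rw [hc'.high _ _ (by omega)] at this
      simp at this)
    (by
      intro z hz
      by_contra hlt
      have h1 : z.2 = 0 := le_antisymm (not_lt.1 hlt) (hsub' hz.1).2.1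
      have := hz.2
      rw [h1, Int.floor_zero, hc'.low _ _ le_rfl] at this
      simp at this)
    (by
      rintro x y y' ⟨-, h1⟩ ⟨-, h2⟩
      by_contra hlt
      have := hm ⌊x⌋ ⌊y'⌋ ⌊y⌋ (Int.floor_le_floor (not_lt.1 hlt)) h2
      simp [this] at h1)
    (by exact_mod_cast hb) (by exact_mod_cast hbm)
  refine ⟨f.trans g, fun z hz => ?_, fun z hz => ?_⟩
  · rw [Homeomorph.trans_apply, hf z fun h => hz ⟨⟨h.1.1.le, h.1.2.le⟩, h.2⟩, hg z hz]
  · rw [Homeomorph.trans_apply]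
    cases h : c' ⌊(f z).1⌋ ⌊(f z).2⌋ with
    | false => exact (hgA _ ⟨mem_image_of_mem f hz, h⟩).ne
    | true => exact (hgB _ ⟨mem_image_of_mem f hz, h⟩).ne'

end IsGridColoring

open Classical in
/-- Colour a cell of `[0, n] × [0, n]` by whether it meets `A`, with forced colours on the border. -/
noncomputable def meetColoring (A : Set (ℝ × ℝ)) (n b i j : ℤ) : Bool :=
  if j ≤ 0 then false else if n ≤ j + 1 then true else
  if i ≤ 0 ∨ n ≤ i + 1 then decide (b ≤ j) else
  decide (¬ (A ∩ Icc (i : ℝ) (i + 1) ×ˢ Icc (j : ℝ) (j + 1)).Nonempty)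

theorem isGridColoring_meetColoring {A B : Set (ℝ × ℝ)} {n b : ℤ} (hb : 0 < b) (hbn : b < n)
    (hx : ∀ z ∈ A ∪ B, 1 < z.1 ∧ z.1 < n - 1) (hA : ∀ z ∈ A, z.2 < n - 1) (hB : ∀ z ∈ B, 1 < z.2)
    (hAB : ∀ z ∈ A, ∀ w ∈ B, ¬ (|z.1 - w.1| ≤ 1 ∧ |z.2 - w.2| ≤ 1)) :
    IsGridColoring (A ∪ B) n n b (meetColoring A n b) := by
  have hcol : ∀ z ∈ A ∪ B, ∃ o, ∀ i j : ℤ, (i : ℝ) ≤ z.1 → z.1 ≤ i + 1 → (j : ℝ) ≤ z.2 →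
      z.2 ≤ j + 1 → meetColoring A n b i j = o := by
    intro z hz
    have hin : ∀ i : ℤ, (i : ℝ) ≤ z.1 → z.1 ≤ i + 1 → ¬ (i ≤ 0 ∨ n ≤ i + 1) := by
      intro i h1 h2
      obtain ⟨h3, h4⟩ := hx z hz
      have e1 : (0 : ℝ) < i := by linarith
      have e2 : (i : ℝ) + 1 < n := by linarith
      have e1 : 0 < i := by exact_mod_cast e1
      have e2 : i + 1 < n := by exact_mod_cast e2
      omega
    rcases hz with hz | hz
    · refine ⟨false, fun i j h1 h2 h3 h4 => ?_⟩
      have e2 : (j : ℝ) + 1 < n := by have := hA z hz; linarith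
      have e2 : j + 1 < n := by exact_mod_cast e2
      unfold meetColoring
      rw [if_neg (show ¬ n ≤ j + 1 by omega), if_neg (hin i h1 h2)]
      split_ifs with h
      · rfl
      · rw [decide_eq_false_iff_not, not_not]
        exact ⟨z, hz, ⟨h1, h2⟩, h3, h4⟩
    · refine ⟨true, fun i j h1 h2 h3 h4 => ?_⟩
      have e2 : (0 : ℝ) < j := by have := hB z hz; linarith
      have e2 : 0 < j := by exact_mod_cast e2
      unfold meetColoring
      rw [if_neg (show ¬ j ≤ 0 by omega), if_neg (hin i h1 h2)]
      split_ifs with h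
      · rfl
      · rw [← Bool.not_eq_false, decide_eq_false_iff_not, not_not]
        rintro ⟨w, hw, ⟨h5, h6⟩, h7, h8⟩
        exact hAB w hw z hz ⟨abs_le.2 ⟨by linarith, by linarith⟩,
          abs_le.2 ⟨by linarith, by linarith⟩⟩
  refine ⟨fun i j hj => ?_, fun i j hj => ?_, fun i j hi => ?_, fun i j hne y h1 h2 hz => ?_,
    fun i j hne x h1 h2 hz => ?_⟩
  · rw [meetColoring, if_pos hj]
  · rw [meetColoring, if_neg (by omega), if_pos hj]
  · unfold meetColoring
    split_ifs with h1 h2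
    · symm; rw [decide_eq_false_iff_not]; omega
    · symm; rw [decide_eq_true_iff]; omega
    · rfl
  · obtain ⟨o, ho⟩ := hcol _ hz
    apply hne
    rw [ho i j (by simp) le_rfl h1 h2, ho (i + 1) j (by simp) (by simp) h1 h2]
  · obtain ⟨o, ho⟩ := hcol _ hz
    apply hne
    rw [ho i j h1 h2 (by simp) le_rfl, ho i (j + 1) h1 h2 (by simp) (by simp)]

theorem exists_homeomorph_avoid_mid {A B : Set (ℝ × ℝ)} (hA : IsCompact A) (hB : IsCompact B)
    (hAB : Disjoint A B) {l r m m' : ℝ} (hlr : l < r) (hmm : m < m')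
    (hx : ∀ z ∈ A ∪ B, l < z.1 ∧ z.1 < r) (hy : ∀ z ∈ A ∪ B, m ≤ z.2 ∧ z.2 ≤ m')
    (hAm : ∀ z ∈ A, z.2 ≠ m') (hBm : ∀ z ∈ B, z.2 ≠ m) :
    ∃ h : ℝ × ℝ ≃ₜ ℝ × ℝ, (∀ z, z ∉ Icc l r ×ˢ Icc m m' → h z = z) ∧
      ∀ z ∈ A ∪ B, (h z).2 ≠ (m + m') / 2 := by
  have hK := hA.union hB
  obtain ⟨ε₁, h₁, hl⟩ := hK.exists_pos_forall_le (f := fun z => z.1 - l) (by fun_prop)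
    fun z hz => sub_pos.2 (hx z hz).1
  obtain ⟨ε₂, h₂, hr⟩ := hK.exists_pos_forall_le (f := fun z => r - z.1) (by fun_prop)
    fun z hz => sub_pos.2 (hx z hz).2
  obtain ⟨ε₃, h₃, hm'⟩ := hA.exists_pos_forall_le (f := fun z => m' - z.2) (by fun_prop)
    fun z hz => sub_pos.2 (lt_of_le_of_ne (hy z (.inl hz)).2 (hAm z hz))
  obtain ⟨ε₄, h₄, hm⟩ := hB.exists_pos_forall_le (f := fun z => z.2 - m) (by fun_prop)
    fun z hz => sub_pos.2 (lt_of_le_of_ne (hy z (.inr hz)).1 (hBm z hz).symm)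
  obtain ⟨ε₅, h₅, hd⟩ := (hA.prod hB).exists_pos_forall_le (f := fun z => dist z.1 z.2)
    (by fun_prop) fun z hz => dist_pos.2 fun h => hAB.ne_of_mem hz.1 hz.2 h
  obtain ⟨ε, hε, hε'⟩ : ∃ ε > 0, ε ≤ ε₁ ∧ ε ≤ ε₂ ∧ ε ≤ ε₃ ∧ ε ≤ ε₄ ∧ ε ≤ ε₅ :=
    ⟨min ε₁ (min ε₂ (min ε₃ (min ε₄ ε₅))), by positivity, by simp, by simp, by simp, by simp,
      by simp⟩
  obtain ⟨e1, e2, e3, e4, e5⟩ := hε'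
  obtain ⟨b, hb₀⟩ := exists_int_gt (max (r - l) (m' - m) / ε)
  have hb : (0 : ℝ) < b := lt_of_le_of_lt
    (div_nonneg (le_max_of_le_left (sub_pos.2 hlr).le) hε.le) hb₀
  rw [div_lt_iff₀ hε, max_lt_iff] at hb₀
  obtain ⟨hb1, hb2⟩ := hb₀
  have hrl := sub_pos.2 hlr
  have hmm' := sub_pos.2 hmm
  set α := 2 * b / (r - l) with hα
  set β := 2 * b / (m' - m) with hβ
  have hα0 : 0 < α := by positivity
  have hβ0 : 0 < β := by positivity
  have hαr : α * (r - l) = 2 * b := by rw [hα]; field_simp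
  have hβr : β * (m' - m) = 2 * b := by rw [hβ]; field_simp
  have hαε : 1 < α * ε := by
    rw [hα, div_mul_eq_mul_div, lt_div_iff₀ hrl]; nlinarith [mul_pos hb hε]
  have hβε : 1 < β * ε := by
    rw [hβ, div_mul_eq_mul_div, lt_div_iff₀ hmm']; nlinarith [mul_pos hb hε]
  let φ : ℝ × ℝ ≃ₜ ℝ × ℝ := (affineHomeomorph α (-(α * l)) hα0.ne').prodCongr
    (affineHomeomorph β (-(β * m)) hβ0.ne')
  have hφ : ∀ z, φ z = (α * (z.1 - l), β * (z.2 - m)) := by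
    intro z
    ext <;> simp [φ, affineHomeomorph] <;> ring
  have hc : IsGridColoring (φ '' A ∪ φ '' B) (2 * b) (2 * b) b
      (meetColoring (φ '' A) (2 * b) b) := by
    have hb' : 0 < b := by exact_mod_cast hb
    refine isGridColoring_meetColoring hb' (by omega) ?_ ?_ ?_ ?_
    · rw [← image_union]
      rintro _ ⟨z, hz, rfl⟩
      rw [hφ]
      push_cast
      have a1 := hl z hz
      have a2 := hr z hz
      constructor <;> nlinarith
    · rintro _ ⟨z, hz, rfl⟩
      rw [hφ]
      push_cast
      have a1 := hm' z hz
      nlinarith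
    · rintro _ ⟨z, hz, rfl⟩
      rw [hφ]
      have a1 := hm z hz
      simp only; nlinarith
    · rintro _ ⟨z, hz, rfl⟩ _ ⟨w, hw, rfl⟩ ⟨a1, a2⟩
      have a3 := hd (z, w) ⟨hz, hw⟩
      rw [hφ, hφ] at a1 a2
      simp only at a1 a2
      rw [← mul_sub, abs_mul, abs_of_pos hα0, sub_sub_sub_cancel_right] at a1
      rw [← mul_sub, abs_mul, abs_of_pos hβ0, sub_sub_sub_cancel_right] at a2
      simp only [Prod.dist_eq, Real.dist_eq] at a3
      rcases le_max_iff.1 a3 with a4 | a4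
      · nlinarith
      · nlinarith
  rw [← image_union] at hc
  obtain ⟨f, hf, hf'⟩ := hc.exists_homeomorph_avoid (hK.image φ.continuous)
    (by
      rintro _ ⟨z, hz, rfl⟩
      rw [hφ]
      push_cast
      have a1 := hx z hz
      have a2 := hy z hz
      refine ⟨⟨?_, ?_⟩, ?_, ?_⟩ <;> simp only <;> nlinarith)
    (by exact_mod_cast hb) (by
      have hb' : 0 < b := by exact_mod_cast hb
      omega)
  refine ⟨(φ.trans f).trans φ.symm, fun z hz => ?_, fun z hz heq => ?_⟩
  · rw [Homeomorph.trans_apply, Homeomorph.trans_apply, hf, φ.symm_apply_apply]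
    rw [hφ]
    push_cast
    rintro ⟨⟨a1, a2⟩, a3, a4⟩
    simp only at a1 a2 a3 a4
    rw [← hαr] at a2
    rw [← hβr] at a4
    apply hz
    refine ⟨⟨?_, ?_⟩, ?_, ?_⟩
    · have := (mul_nonneg_iff_of_pos_left hα0).1 a1; linarith
    · have := le_of_mul_le_mul_left a2 hα0; linarith
    · have := (mul_nonneg_iff_of_pos_left hβ0).1 a3; linarith
    · have := le_of_mul_le_mul_left a4 hβ0; linarith
  · apply hf' _ (mem_image_of_mem φ hz)
    have : f (φ z) = φ (((φ.trans f).trans φ.symm) z) := by simp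
    rw [this, hφ, heq]
    simp only
    linarith

theorem IsCompact.exists_compact_partition {X : Type*} [TopologicalSpace X] [T2Space X]
    {K Z W : Set X} (hK : IsCompact K) (hT : IsTotallyDisconnected K) (hZ : IsClosed Z)
    (hW : IsClosed W) (hZW : Disjoint Z W) :
    ∃ A B : Set X, IsCompact A ∧ IsCompact B ∧ Disjoint A B ∧ A ∪ B = K ∧ Disjoint A W ∧
      Disjoint B Z := by
  have := isCompact_iff_compactSpace.1 hK
  have := (totallyDisconnectedSpace_subtype_iff (s := K)).2 hT
  obtain ⟨C, hC, hZC, hCW⟩ := exists_clopen_of_closed_subset_open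
    (hZ.preimage (continuous_subtype_val (p := (· ∈ K))))
    (hW.preimage (continuous_subtype_val (p := (· ∈ K)))).isOpen_compl
    (fun x hx hx' => hZW.le_bot ⟨hx, hx'⟩)
  refine ⟨(↑) '' C, (↑) '' Cᶜ, hC.1.isCompact.image continuous_subtype_val,
    hC.compl.1.isCompact.image continuous_subtype_val,
    (disjoint_image_iff Subtype.val_injective).2 disjoint_compl_right, ?_, ?_, ?_⟩
  · rw [← image_union, union_compl_self, image_univ, Subtype.range_coe]
  · rw [disjoint_left]
    rintro _ ⟨x, hx, rfl⟩ hxW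
    exact hCW hx hxW
  · rw [disjoint_left]
    rintro _ ⟨x, hx, rfl⟩ hxZ
    exact hx (hZC hxZ)

theorem exists_horizontal_notMem {K : Set (ℝ × ℝ)} (hT : IsTotallyDisconnected K) (t : ℝ) {u v : ℝ}
    (huv : u < v) : ∃ x ∈ Ioo u v, (x, t) ∉ K := by
  by_contra! hcon
  have h1 : ((fun x => (x, t)) '' Ioo u v).Subsingleton :=
    hT _ (by rintro _ ⟨x, hx, rfl⟩; exact hcon x hx)
      (isPreconnected_Ioo.image _ (by fun_prop))
  obtain ⟨x, hx⟩ := exists_between huv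
  obtain ⟨y, hy⟩ := exists_between hx.2
  have := h1 (mem_image_of_mem _ hx) (mem_image_of_mem _ ⟨hx.1.trans hy.1, hy.2⟩)
  simp only [Prod.mk.injEq, and_true] at this
  exact hy.1.ne this

theorem exists_homeomorph_avoid_box {K : Set (ℝ × ℝ)} (hK : IsCompact K)
    (hT : IsTotallyDisconnected K) {l r t η : ℝ} (hlr : l < r) (hη : 0 < η)
    (hl : ∀ y ∈ Icc (t - η) (t + η), (l, y) ∉ K) (hr : ∀ y ∈ Icc (t - η) (t + η), (r, y) ∉ K) :
    ∃ h : ℝ × ℝ ≃ₜ ℝ × ℝ, (∀ z, z ∉ Ioc l r ×ˢ Icc (t - η) (t + η) → h z = z) ∧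
      ∀ z ∈ K, z.1 ∈ Ioc l r → (h z).2 ≠ t := by
  have hbox : IsClosed (Icc l r ×ˢ Icc (t - η) (t + η)) := isClosed_Icc.prod isClosed_Icc
  obtain ⟨A, B, hA, hB, hAB, hK', hAW, hBZ⟩ := (hK.inter_right hbox).exists_compact_partition
    (fun s hs => hT s (hs.trans inter_subset_left))
    (isClosed_eq continuous_snd continuous_const : IsClosed {z : ℝ × ℝ | z.2 = t - η})
    (isClosed_eq continuous_snd continuous_const : IsClosed {z : ℝ × ℝ | z.2 = t + η})
    (disjoint_left.2 fun z (h1 : z.2 = _) (h2 : z.2 = _) => by linarith)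
  obtain ⟨h, hh, hh'⟩ := exists_homeomorph_avoid_mid hA hB hAB hlr (m := t - η) (m' := t + η)
    (by linarith)
    (by
      intro z hz
      rw [hK'] at hz
      refine ⟨lt_of_le_of_ne hz.2.1.1 ?_, lt_of_le_of_ne hz.2.1.2 ?_⟩
      · intro heq
        exact hl z.2 hz.2.2 (by rw [heq]; exact hz.1)
      · intro heq
        exact hr z.2 hz.2.2 (by rw [← heq]; exact hz.1))
    (by
      intro z hz
      rw [hK'] at hz
      exact hz.2.2)
    (fun z hz heq => hAW.le_bot ⟨hz, heq⟩) (fun z hz heq => hBZ.le_bot ⟨hz, heq⟩)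
  have hfix : ∀ z, z ∉ Ioc l r ×ˢ Icc (t - η) (t + η) → h z = z := by
    intro z hz
    rcases le_or_gt z.1 l with hzl | hzl
    · have hcl : IsClosed {z | h z = z} := isClosed_eq h.continuous continuous_id
      have : closure (Iio l ×ˢ univ) ⊆ {z | h z = z} := by
        refine hcl.closure_subset_iff.2 fun w hw => hh w fun hw' => ?_
        exact not_lt.2 hw'.1.1 hw.1
      rw [closure_prod_eq, closure_Iio, closure_univ] at this
      exact this ⟨hzl, mem_univ _⟩
    · exact hh z fun hz' => hz ⟨⟨hzl, hz'.1.2⟩, hz'.2⟩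
  refine ⟨h, hfix, fun z hz hzx => ?_⟩
  by_cases hzy : z.2 ∈ Icc (t - η) (t + η)
  · have := hh' z (by rw [hK']; exact ⟨hz, ⟨hzx.1.le, hzx.2⟩, hzy⟩)
    rwa [show (t - η + (t + η)) / 2 = t by ring] at this
  · rw [hfix z fun h => hzy h.2]
    rintro rfl
    exact hzy ⟨by linarith, by linarith⟩

theorem exists_homeomorph_avoid_strip {K : Set (ℝ × ℝ)} (hK : IsCompact K)
    (hT : IsTotallyDisconnected K) {x : ℕ → ℝ} (hx : StrictMono x) {t η ε : ℝ} (hη : 0 < η)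
    (hηε : 2 * η ≤ ε) (hxε : ∀ i, x (i + 1) - x i ≤ ε) (N : ℕ)
    (hxK : ∀ i ≤ N, ∀ y ∈ Icc (t - η) (t + η), (x i, y) ∉ K) :
    ∃ h : ℝ × ℝ ≃ₜ ℝ × ℝ, (∀ z, z ∉ Ioc (x 0) (x N) ×ˢ Icc (t - η) (t + η) → h z = z) ∧
      (∀ z, dist (h z) z ≤ ε) ∧ ∀ z ∈ K, z.1 ∈ Ioc (x 0) (x N) → (h z).2 ≠ t := by
  induction N with
  | zero => exact ⟨.refl _, fun z _ => rfl, fun z => by simpa using by linarith, by simp⟩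
  | succ k ih =>
    obtain ⟨f, hf, hfε, hft⟩ := ih fun i hi => hxK i (by omega)
    obtain ⟨g, hg, hgt⟩ := exists_homeomorph_avoid_box hK hT (hx (lt_add_one k)) hη
      (hxK k (by omega)) (hxK (k + 1) le_rfl)
    have h0 : x 0 ≤ x k := hx.monotone (Nat.zero_le k)
    have h1 : x k < x (k + 1) := hx (lt_add_one k)
    have hfg : ∀ z : ℝ × ℝ, z.1 ≤ x k → g (f z) = f z := by
      intro z hz
      have : f z ∈ {w : ℝ × ℝ | w.1 ≤ x k} := f.mem_of_forall_notMem hf (fun w hw => hw.1.2) hz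
      exact hg _ fun hw => not_lt.2 this hw.1.1
    have hff : ∀ z : ℝ × ℝ, x k < z.1 → f z = z := fun z hz =>
      hf z fun h => not_lt.2 h.1.2 hz
    refine ⟨f.trans g, fun z hz => ?_, fun z => ?_, fun z hz hzx => ?_⟩
    · rw [Homeomorph.trans_apply]
      rw [hf z fun h => hz ⟨⟨h.1.1, h.1.2.trans h1.le⟩, h.2⟩]
      exact hg z fun h => hz ⟨⟨h0.trans_lt h.1.1, h.1.2⟩, h.2⟩
    · rw [Homeomorph.trans_apply]
      rcases le_or_gt z.1 (x k) with hzk | hzk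
      · rw [hfg z hzk]; exact hfε z
      rw [hff z hzk]
      by_cases hz : z ∈ Ioc (x k) (x (k + 1)) ×ˢ Icc (t - η) (t + η)
      · have h2 := g.mem_of_forall_notMem hg Subset.rfl hz
        rw [Prod.dist_eq, Real.dist_eq, Real.dist_eq]
        obtain ⟨⟨a1, a2⟩, a3, a4⟩ := hz
        obtain ⟨⟨b1, b2⟩, b3, b4⟩ := h2
        have := hxε k
        refine max_le (abs_le.2 ⟨by linarith, by linarith⟩) (abs_le.2 ⟨by linarith, by linarith⟩)
      · rw [hg z hz, dist_self]; linarith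
    · rw [Homeomorph.trans_apply]
      rcases le_or_gt z.1 (x k) with hzk | hzk
      · rw [hfg z hzk]; exact hft z hz ⟨hzx.1, hzk⟩
      · rw [hff z hzk]; exact hgt z hz ⟨hzk, hzx.2⟩

theorem exists_homeomorph_avoid_horizontal {K : Set (ℝ × ℝ)} (hK : IsCompact K)
    (hT : IsTotallyDisconnected K) (t : ℝ) {ε : ℝ} (hε : 0 < ε) :
    ∃ h : ℝ × ℝ ≃ₜ ℝ × ℝ, (∀ z, dist (h z) z ≤ ε) ∧ ∀ z ∈ K, (h z).2 ≠ t := by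
  obtain ⟨M, hM⟩ := (hK.image continuous_fst).isBounded.exists_norm_le
  have hM' : ∀ z ∈ K, |z.1| ≤ M := fun z hz => hM _ (mem_image_of_mem _ hz)
  have hex : ∀ i : ℕ, ∃ x ∈ Ioo (-M - ε + i * (ε / 2)) (-M - ε + (i + 1) * (ε / 2)), (x, t) ∉ K :=
    fun i => exists_horizontal_notMem hT t (by nlinarith)
  choose x hx hxK using hex
  have hmono : StrictMono x := strictMono_nat_of_lt_succ fun i => by
    have h1 := (hx i).2
    have h2 := (hx (i + 1)).1
    push_cast at h2
    linarith
  obtain ⟨N, hN⟩ := exists_nat_gt ((2 * M + ε) / (ε / 2))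
  rw [div_lt_iff₀ (by positivity)] at hN
  have hcl : IsClosed {z : ℝ × ℝ | z.1 ∈ x '' Iic N} :=
    ((finite_Iic N).image x).isClosed.preimage continuous_fst
  obtain ⟨δ, hδ, hδK⟩ := (hK.inter_right hcl).exists_pos_forall_le (f := fun z => |z.2 - t|)
    (by fun_prop) (by
      rintro ⟨x', y⟩ ⟨hz, i, hi, heq⟩
      simp only at heq
      subst heq
      refine abs_pos.2 (sub_ne_zero.2 ?_)
      rintro rfl
      exact hxK i hz)
  obtain ⟨h, -, hh, hh'⟩ := exists_homeomorph_avoid_strip hK hT hmono (t := t)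
    (η := min ε δ / 2) (ε := ε) (by positivity) (by linarith [min_le_left ε δ])
    (fun i => by
      have h1 := (hx i).1
      have h2 := (hx (i + 1)).2
      push_cast at h2
      linarith) N
    (fun i hi y hy hz => by
      have h1 := hδK _ ⟨hz, i, hi, rfl⟩
      have h2 : |y - t| ≤ min ε δ / 2 := abs_le.2 ⟨by linarith [hy.1], by linarith [hy.2]⟩
      simp only at h1
      linarith [min_le_right ε δ])
  refine ⟨h, hh, fun z hz => hh' z hz ?_⟩
  have h0 := (hx 0).2
  have h1 := (hx N).1
  have h2 := abs_le.1 (hM' z hz)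
  push_cast at h0
  constructor <;> linarith

theorem exists_homeomorph_avoid_vertical {K : Set (ℝ × ℝ)} (hK : IsCompact K)
    (hT : IsTotallyDisconnected K) (t : ℝ) {ε : ℝ} (hε : 0 < ε) :
    ∃ h : ℝ × ℝ ≃ₜ ℝ × ℝ, (∀ z, dist (h z) z ≤ ε) ∧ ∀ z ∈ K, (h z).1 ≠ t := by
  let σ := Homeomorph.prodComm ℝ ℝ
  obtain ⟨h, hh, hh'⟩ := exists_homeomorph_avoid_horizontal (hK.image σ.continuous)
    (σ.isEmbedding.isTotallyDisconnected_image.2 hT) t hε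
  refine ⟨(σ.trans h).trans σ, fun z => ?_, fun z hz => hh' _ (mem_image_of_mem _ hz)⟩
  have := hh (σ z)
  rw [Prod.dist_eq] at this ⊢
  rw [max_comm]
  exact this

/-- Pairs of mutually inverse continuous self-maps of the plane. -/
def planeHomeos : Set (C(ℝ × ℝ, ℝ × ℝ) × C(ℝ × ℝ, ℝ × ℝ)) :=
  {p | p.1.comp p.2 = .id _ ∧ p.2.comp p.1 = .id _}

theorem isClosed_planeHomeos : IsClosed planeHomeos :=
  (isClosed_eq (continuous_fst.compCM continuous_snd) continuous_const).inter
    (isClosed_eq (continuous_snd.compCM continuous_fst) continuous_const)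

instance : BaireSpace planeHomeos :=
  have := isClosed_planeHomeos.completeSpace_coe
  inferInstance

/-- The pair consisting of a homeomorphism and its inverse. -/
def Homeomorph.toPlaneHomeos (g : ℝ × ℝ ≃ₜ ℝ × ℝ) : planeHomeos :=
  ⟨(⟨g, g.continuous⟩, ⟨g.symm, g.symm.continuous⟩), by ext1; simp, by ext1; simp⟩

theorem surjective_toPlaneHomeos : Function.Surjective Homeomorph.toPlaneHomeos := by
  rintro ⟨⟨f, f'⟩, h, h'⟩
  exact ⟨⟨⟨f, f', fun x => congrFun (congrArg DFunLike.coe h') x,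
    fun x => congrFun (congrArg DFunLike.coe h) x⟩, f.continuous, f'.continuous⟩, rfl⟩

theorem tendsto_id_of_dist_le {s : ℕ → C(ℝ × ℝ, ℝ × ℝ)}
    (hs : ∀ n z, dist (s n z) z ≤ 1 / ((n : ℝ) + 1)) : Tendsto s atTop (𝓝 (.id _)) := by
  refine ContinuousMap.tendsto_of_tendstoLocallyUniformly
    (TendstoUniformly.tendstoLocallyUniformly ?_)
  rw [Metric.tendstoUniformly_iff]
  intro ε hε
  filter_upwards [tendsto_one_div_add_atTop_nhds_zero_nat.eventually_lt_const hε] with n hn z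
  rw [dist_comm]
  exact (hs n z).trans_lt hn

theorem toPlaneHomeos_mem_closure {g : ℝ × ℝ ≃ₜ ℝ × ℝ} {O : Set C(ℝ × ℝ, ℝ × ℝ)}
    (h : ∀ ε > 0, ∃ s : ℝ × ℝ ≃ₜ ℝ × ℝ, (∀ z, dist (s z) z ≤ ε) ∧
      (⟨g.trans s, (g.trans s).continuous⟩ : C(ℝ × ℝ, ℝ × ℝ)) ∈ O) :
    g.toPlaneHomeos ∈ closure {p : planeHomeos | p.1.1 ∈ O} := by
  have : ∀ n : ℕ, (0 : ℝ) < 1 / ((n : ℝ) + 1) := fun n => by positivity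
  choose s hs hsO using fun n : ℕ => h _ (this n)
  refine mem_closure_of_tendsto (f := fun n => (g.trans (s n)).toPlaneHomeos) (b := atTop)
    (tendsto_subtype_rng.2 (Tendsto.prodMk_nhds ?_ ?_)) (.of_forall hsO)
  · have h1 := tendsto_id_of_dist_le (s := fun n => ⟨s n, (s n).continuous⟩) hs
    simpa using h1.compCM (tendsto_const_nhds (x := (⟨g, g.continuous⟩ : C(ℝ × ℝ, ℝ × ℝ))))
  · have h1 := tendsto_id_of_dist_le (s := fun n => ⟨(s n).symm, (s n).symm.continuous⟩)
      fun n z => by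
        have := hs n ((s n).symm z)
        rwa [(s n).apply_symm_apply, dist_comm] at this
    have h2 := (tendsto_const_nhds
      (x := (⟨g.symm, g.symm.continuous⟩ : C(ℝ × ℝ, ℝ × ℝ)))).compCM h1
    rw [ContinuousMap.comp_id] at h2
    exact h2

/-- Baire category for homeomorphisms of the plane, in two stages. -/
theorem exists_homeomorph_forall_mem {ι κ : Type*} [Countable ι] [Countable κ]
    {V : ι → Set C(ℝ × ℝ, ℝ × ℝ)} {W : κ → Set C(ℝ × ℝ, ℝ × ℝ)}
    (hVo : ∀ i, IsOpen (V i)) (hWo : ∀ i, IsOpen (W i))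
    (hV : ∀ i (g : ℝ × ℝ ≃ₜ ℝ × ℝ), ∀ ε > 0, ∃ s : ℝ × ℝ ≃ₜ ℝ × ℝ, (∀ z, dist (s z) z ≤ ε) ∧
      (⟨g.trans s, (g.trans s).continuous⟩ : C(ℝ × ℝ, ℝ × ℝ)) ∈ V i)
    (hW : ∀ k (g : ℝ × ℝ ≃ₜ ℝ × ℝ), (∀ i, (⟨g, g.continuous⟩ : C(ℝ × ℝ, ℝ × ℝ)) ∈ V i) →
      ∀ ε > 0, ∃ s : ℝ × ℝ ≃ₜ ℝ × ℝ, (∀ z, dist (s z) z ≤ ε) ∧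
        (⟨g.trans s, (g.trans s).continuous⟩ : C(ℝ × ℝ, ℝ × ℝ)) ∈ W k) :
    ∃ g : ℝ × ℝ ≃ₜ ℝ × ℝ, ∀ k, (⟨g, g.continuous⟩ : C(ℝ × ℝ, ℝ × ℝ)) ∈ W k := by
  have hcont : Continuous fun p : planeHomeos => p.1.1 :=
    continuous_fst.comp continuous_subtype_val
  have hVd : Dense (⋂ i, {p : planeHomeos | p.1.1 ∈ V i}) :=
    dense_iInter_of_isOpen (fun i => (hVo i).preimage hcont) fun i p => by
      obtain ⟨g, rfl⟩ := surjective_toPlaneHomeos p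
      exact toPlaneHomeos_mem_closure (hV i g)
  have hWd : Dense (⋂ k, {p : planeHomeos | p.1.1 ∈ W k}) :=
    dense_iInter_of_isOpen (fun i => (hWo i).preimage hcont) fun k => by
      refine (hVd.mono fun p hp => ?_).of_closure
      obtain ⟨g, rfl⟩ := surjective_toPlaneHomeos p
      exact toPlaneHomeos_mem_closure (hW k g fun i => mem_iInter.1 hp i)
  have : Nonempty planeHomeos := ⟨(Homeomorph.refl _).toPlaneHomeos⟩
  obtain ⟨p, hp⟩ := hWd.nonempty
  obtain ⟨g, rfl⟩ := surjective_toPlaneHomeos p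
  exact ⟨g, fun k => mem_iInter.1 hp k⟩

/-- A continuous monotone function agreeing with the floor on a compact set of non-integers. -/
theorem exists_monotone_eq_floor {X : Set ℝ} (hX : IsCompact X) (hXZ : ∀ x ∈ X, ∀ n : ℤ, x ≠ n) :
    ∃ f : ℝ → ℝ, Continuous f ∧ Monotone f ∧ (∀ x, |f x - x| ≤ 1) ∧ ∀ x ∈ X, f x = ⌊x⌋ := by
  have hcl : IsClosed (range ((↑) : ℤ → ℝ)) := Int.isClosedEmbedding_coe_real.isClosed_range
  obtain ⟨ρ, hρ, hρX⟩ := hX.exists_pos_forall_le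
    (f := fun x => Metric.infDist x (range ((↑) : ℤ → ℝ))) (Metric.continuous_infDist_pt _)
    fun x hx => (hcl.notMem_iff_infDist_pos (range_nonempty _)).1
      (by rintro ⟨n, hn⟩; exact hXZ x hx n hn.symm)
  set σ := min ρ 1 with hσ
  have hσ0 : 0 < σ := by positivity
  have hσ1 : σ ≤ 1 := min_le_right _ _
  set φ : ℝ → ℝ := fun t => max 0 (1 - (1 - t) / σ) with hφ
  have hφc : Continuous φ := by fun_prop
  have hφm : Monotone φ := fun a b hab => by
    simp only [hφ]
    gcongr
  have hφ0 : ∀ t, 0 ≤ φ t := fun t => le_max_left _ _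
  have hφ1 : ∀ t ≤ 1, φ t ≤ 1 := fun t ht =>
    max_le zero_le_one (by have := div_nonneg (sub_nonneg.2 ht) hσ0.le; linarith)
  have hf : ∀ x : ℝ, x - (Int.fract x - φ (Int.fract x)) = ⌊x⌋ + φ (Int.fract x) := fun x => by
    have := Int.floor_add_fract x
    linarith
  have hfr : ∀ x : ℝ, Int.fract x ≤ 1 := fun x => (Int.fract_lt_one x).le
  refine ⟨fun x => x - (Int.fract x - φ (Int.fract x)), ?_, ?_, ?_, ?_⟩
  · have : Continuous ((fun t => t - φ t) ∘ Int.fract) :=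
      ContinuousOn.comp_fract'' (by fun_prop) (by
        simp only [hφ]
        have : 1 ≤ 1 / σ := by rw [le_div_iff₀ hσ0]; linarith
        simp
        simpa using this)
    exact continuous_id.sub this
  · intro x y hxy
    simp only [hf]
    rcases (Int.floor_le_floor hxy).eq_or_lt with h | h
    · have : Int.fract x ≤ Int.fract y := by
        rw [Int.fract, Int.fract, h]; linarith
      rw [h]
      have := hφm this
      linarith
    · have h1 : ((⌊x⌋ : ℝ)) + 1 ≤ ⌊y⌋ := by exact_mod_cast h
      linarith [hφ1 _ (hfr x), hφ0 (Int.fract y)]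
  · intro x
    rw [abs_le]
    constructor <;> linarith [hφ1 _ (hfr x), hφ0 (Int.fract x), hfr x, Int.fract_nonneg x]
  · intro x hx
    simp only [hf]
    have h1 := (hρX x hx).trans (Metric.infDist_le_dist_of_mem (mem_range_self (⌊x⌋ + 1)))
    have h2 : dist x ((⌊x⌋ + 1 : ℤ) : ℝ) = 1 - Int.fract x := by
      rw [Real.dist_eq, abs_sub_comm, abs_of_nonneg]
      · push_cast; rw [Int.fract]; ring
      · push_cast; linarith [Int.lt_floor_add_one x]
    rw [h2] at h1
    have h3 : 1 ≤ (1 - Int.fract x) / σ := by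
      rw [le_div_iff₀ hσ0]; linarith [min_le_left ρ 1]
    have h4 : φ (Int.fract x) = 0 := max_eq_left (by linarith)
    rw [h4, add_zero]

theorem abs_floor_le_add_one {x M : ℝ} (h : |x| ≤ M) : |((⌊x⌋ : ℤ) : ℝ)| ≤ M + 1 := by
  have h1 := Int.floor_le x
  have h2 := Int.lt_floor_add_one x
  rw [abs_le] at h ⊢
  constructor <;> linarith

theorem exists_homeomorph_spread {L : Set (ℝ × ℝ)} (hL : IsCompact L)
    (hq : ∀ z ∈ L, ∀ q : ℚ, z.1 ≠ q ∧ z.2 ≠ q) {δ ε : ℝ} (hδ : 0 < δ) (hε : 0 < ε) :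
    ∃ s : ℝ × ℝ ≃ₜ ℝ × ℝ, (∀ z, dist (s z) z ≤ ε) ∧
      ∀ u ∈ L, ∀ v ∈ L, δ ≤ dist u v → (s u).1 ≠ (s v).1 := by
  obtain ⟨N, hN⟩ := exists_nat_gt (max (1 / δ) (2 / ε))
  rw [max_lt_iff] at hN
  have hN0 : (0 : ℝ) < N := lt_trans (by positivity) hN.1
  have hNδ : 1 < N * δ := by have := hN.1; rwa [div_lt_iff₀ hδ] at this
  have hNε : 2 < N * ε := by have := hN.2; rwa [div_lt_iff₀ hε] at this
  have hint : ∀ x : ℝ, (∀ q : ℚ, x ≠ q) → ∀ n : ℤ, N * x ≠ n := by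
    intro x hx n hn
    apply hx (n / N)
    push_cast
    rw [eq_div_iff hN0.ne', mul_comm, hn]
  obtain ⟨l, hlc, hlm, hl1, hl⟩ := exists_monotone_eq_floor
    (hL.image (f := fun z : ℝ × ℝ => N * z.1) (by fun_prop))
    (by rintro _ ⟨z, hz, rfl⟩; exact hint _ fun q => (hq z hz q).1)
  obtain ⟨μ, hμc, -, -, hμ⟩ := exists_monotone_eq_floor
    (hL.image (f := fun z : ℝ × ℝ => N * z.2) (by fun_prop))
    (by rintro _ ⟨z, hz, rfl⟩; exact hint _ fun q => (hq z hz q).2)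
  obtain ⟨M₀, hM₀⟩ := (hL.image (f := fun z : ℝ × ℝ => (N : ℝ) • z)
    (by fun_prop)).isBounded.exists_norm_le
  obtain ⟨M, hM0, hM⟩ : ∃ M : ℝ, 0 ≤ M ∧ M₀ ≤ M := ⟨max 0 M₀, le_max_left _ _, le_max_right _ _⟩
  have hMx : ∀ z ∈ L, |N * z.1| ≤ M := fun z hz =>
    ((norm_fst_le ((N : ℝ) • z)).trans (hM₀ _ ⟨z, hz, rfl⟩)).trans hM
  have hMy : ∀ z ∈ L, |N * z.2| ≤ M := fun z hz =>
    ((norm_snd_le ((N : ℝ) • z)).trans (hM₀ _ ⟨z, hz, rfl⟩)).trans hM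
  set m : ℝ → ℝ := fun y => max (-(M + 1)) (min (M + 1) (μ (N * y))) with hm
  have hmb : ∀ y, |m y| ≤ M + 1 := fun y =>
    abs_le.2 ⟨le_max_left _ _, max_le (by linarith) (min_le_left _ _)⟩
  have hmL : ∀ z ∈ L, m z.2 = ⌊N * z.2⌋ := by
    intro z hz
    simp only [hm, hμ _ ⟨z, hz, rfl⟩]
    have := abs_le.1 (abs_floor_le_add_one (hMy z hz))
    rw [min_eq_right this.2, max_eq_right this.1]
  set τ' : ℝ := 1 / (8 * (M + 1)) with hτ'
  set τ : ℝ := τ' / (4 * (M + 1)) with hτ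
  have hτ'0 : 0 < τ' := by positivity
  have hτ0 : 0 < τ := by positivity
  have e1 : τ' * (M + 1) = 1 / 8 := by rw [hτ']; field_simp
  have e2 : τ * (M + 1) = τ' / 4 := by rw [hτ]; field_simp
  have e3 : τ' ≤ 1 / 8 := by nlinarith
  have e4 : τ ≤ 1 / 8 := by nlinarith
  have h1τ : 0 ≤ 1 - τ := by linarith
  have hbd : ∀ x y, |((1 - τ) * l (N * x) + τ * (N * x) + τ' * m y) / N - x| ≤ ε := by
    intro x y
    have h1 : ((1 - τ) * l (N * x) + τ * (N * x) + τ' * m y) / N - x =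
        ((1 - τ) * (l (N * x) - N * x) + τ' * m y) / N := by field_simp; ring
    rw [h1, abs_div, abs_of_pos hN0, div_le_iff₀ hN0]
    refine (abs_add_le _ _).trans ?_
    rw [abs_mul, abs_mul, abs_of_nonneg h1τ, abs_of_pos hτ'0]
    have h2 := mul_le_mul_of_nonneg_left (hl1 (N * x)) h1τ
    have h3 := mul_le_mul_of_nonneg_left (hmb y) hτ'0.le
    linarith
  obtain ⟨s, hs⟩ := exists_homeomorph_of_fiberwise
    (f := fun x y => ((1 - τ) * l (N * x) + τ * (N * x) + τ' * m y) / N) (by fun_prop)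
    (fun y x x' hx => by
      have h1 : (N : ℝ) * x < N * x' := mul_lt_mul_of_pos_left hx hN0
      have h2 := mul_le_mul_of_nonneg_left (hlm h1.le) h1τ
      have h3 := mul_lt_mul_of_pos_left h1 hτ0
      simp only
      gcongr ?_ / _
      linarith)
    hbd
  refine ⟨s, fun z => ?_, fun u hu v hv huv heq => ?_⟩
  · have h1 : |(s z).1 - z.1| ≤ ε := by
      rw [hs]
      exact hbd _ _
    have h2 : (s z).2 = z.2 := by rw [hs]
    rw [Prod.dist_eq, h2, dist_self, Real.dist_eq]
    exact max_le h1 hε.le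
  · simp only [hs] at heq
    rw [div_left_inj' hN0.ne', hl _ ⟨u, hu, rfl⟩, hl _ ⟨v, hv, rfl⟩, hmL u hu, hmL v hv] at heq
    have a1 := abs_le.1 (hMx u hu)
    have a2 := abs_le.1 (hMx v hv)
    have a3 := abs_le.1 (abs_floor_le_add_one (hMy u hu))
    have a4 := abs_le.1 (abs_floor_le_add_one (hMy v hv))
    have key : (1 - τ) * ((⌊N * u.1⌋ : ℝ) - ⌊N * v.1⌋) + τ' * ((⌊N * u.2⌋ : ℝ) - ⌊N * v.2⌋) =
      τ * (N * v.1 - N * u.1) := by linarith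
    have b1 : |τ * (N * v.1 - N * u.1)| ≤ τ' / 2 := by
      rw [abs_mul, abs_of_pos hτ0]
      have : |N * v.1 - N * u.1| ≤ 2 * (M + 1) := abs_le.2 ⟨by linarith, by linarith⟩
      nlinarith
    have b2 : |τ' * ((⌊N * u.2⌋ : ℝ) - ⌊N * v.2⌋)| ≤ 1 / 4 := by
      rw [abs_mul, abs_of_pos hτ'0]
      have : |(⌊N * u.2⌋ : ℝ) - ⌊N * v.2⌋| ≤ 2 * (M + 1) := abs_le.2 ⟨by linarith, by linarith⟩
      nlinarith
    have hone : ∀ a b : ℤ, a ≠ b → (1 : ℝ) ≤ |(a : ℝ) - b| := by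
      intro a b hab
      have := Int.one_le_abs (sub_ne_zero.2 hab)
      exact_mod_cast this
    have c1 : ⌊N * u.1⌋ = ⌊N * v.1⌋ := by
      by_contra hne
      have h1 := hone _ _ hne
      have h2 : |(1 - τ) * ((⌊N * u.1⌋ : ℝ) - ⌊N * v.1⌋)| ≤ τ' / 2 + 1 / 4 := by
        rw [eq_sub_of_add_eq key]
        exact (abs_sub _ _).trans (add_le_add b1 b2)
      rw [abs_mul, abs_of_nonneg h1τ] at h2
      nlinarith
    have c2 : ⌊N * u.2⌋ = ⌊N * v.2⌋ := by
      by_contra hne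
      have h1 := hone _ _ hne
      rw [c1, sub_self, mul_zero, zero_add] at key
      rw [← key, abs_mul, abs_of_pos hτ'0] at b1
      nlinarith
    have d1 := Int.abs_sub_lt_one_of_floor_eq_floor c1
    have d2 := Int.abs_sub_lt_one_of_floor_eq_floor c2
    rw [← mul_sub, abs_mul, abs_of_pos hN0] at d1 d2
    rw [Prod.dist_eq, Real.dist_eq, Real.dist_eq] at huv
    rcases le_max_iff.1 huv with h | h
    · have := mul_le_mul_of_nonneg_left h hN0.le
      linarith
    · have := mul_le_mul_of_nonneg_left h hN0.le
      linarith

theorem IsCompact.isOpen_forall_mem {X Y : Type*} [TopologicalSpace X] [TopologicalSpace Y]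
    {S : Set Y} (hS : IsCompact S) {U : Set (X × Y)} (hU : IsOpen U) :
    IsOpen {x | ∀ y ∈ S, (x, y) ∈ U} := by
  rw [isOpen_iff_mem_nhds]
  intro x hx
  exact hS.eventually_forall_of_forall_eventually (P := fun x y => (x, y) ∈ U)
    fun y hy => hU.mem_nhds (hx y hy)

theorem exists_homeomorph_injOn_fst {K : Set (ℝ × ℝ)} (hK : IsCompact K)
    (hT : IsTotallyDisconnected K) :
    ∃ g : ℝ × ℝ ≃ₜ ℝ × ℝ, InjOn (fun z => (g z).1) K := by
  have hS : ∀ n : ℕ, IsCompact {p : (ℝ × ℝ) × (ℝ × ℝ) |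
      p ∈ K ×ˢ K ∧ 1 / ((n : ℝ) + 1) ≤ dist p.1 p.2} := fun n =>
    (hK.prod hK).inter_right (isClosed_le continuous_const (continuous_fst.dist continuous_snd))
  have hne : ∀ q : ℝ, IsOpen ({q}ᶜ : Set ℝ) := fun q => isOpen_compl_singleton
  obtain ⟨g, hg⟩ := exists_homeomorph_forall_mem (ι := ℚ ⊕ ℚ) (κ := ℕ)
    (V := Sum.elim (fun q => {f | ∀ z ∈ K, (f z).1 ≠ q}) (fun q => {f | ∀ z ∈ K, (f z).2 ≠ q}))
    (W := fun n => {f | ∀ p ∈ {p : (ℝ × ℝ) × (ℝ × ℝ) |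
      p ∈ K ×ˢ K ∧ 1 / ((n : ℝ) + 1) ≤ dist p.1 p.2}, (f p.1).1 ≠ (f p.2).1})
    (by
      rintro (q | q)
      · exact hK.isOpen_forall_mem (U := {p : C(ℝ × ℝ, ℝ × ℝ) × (ℝ × ℝ) | (p.1 p.2).1 ≠ q})
          (isOpen_ne_fun (by fun_prop) continuous_const)
      · exact hK.isOpen_forall_mem (U := {p : C(ℝ × ℝ, ℝ × ℝ) × (ℝ × ℝ) | (p.1 p.2).2 ≠ q})
          (isOpen_ne_fun (by fun_prop) continuous_const))
    (fun n => (hS n).isOpen_forall_mem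
      (U := {p : C(ℝ × ℝ, ℝ × ℝ) × ((ℝ × ℝ) × (ℝ × ℝ)) | (p.1 p.2.1).1 ≠ (p.1 p.2.2).1})
      (isOpen_ne_fun (by fun_prop) (by fun_prop)))
    (by
      have hgT : ∀ g : ℝ × ℝ ≃ₜ ℝ × ℝ, IsTotallyDisconnected (g '' K) := fun g =>
        g.isEmbedding.isTotallyDisconnected_image.2 hT
      rintro (q | q) g ε hε
      · obtain ⟨s, hs, hs'⟩ := exists_homeomorph_avoid_vertical (hK.image g.continuous) (hgT g) q hε
        exact ⟨s, hs, fun z hz => hs' _ (mem_image_of_mem g hz)⟩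
      · obtain ⟨s, hs, hs'⟩ := exists_homeomorph_avoid_horizontal (hK.image g.continuous) (hgT g) q
          hε
        exact ⟨s, hs, fun z hz => hs' _ (mem_image_of_mem g hz)⟩)
    (by
      intro n g hg ε hε
      obtain ⟨δ, hδ, hδ'⟩ := (hS n).exists_pos_forall_le (f := fun p => dist (g p.1) (g p.2))
        (by fun_prop) (by
          rintro p ⟨-, hp⟩
          have h1 : 0 < dist p.1 p.2 := lt_of_lt_of_le (by positivity) hp
          exact dist_pos.2 (g.injective.ne (dist_pos.1 h1)))
      obtain ⟨s, hs, hs'⟩ := exists_homeomorph_spread (hK.image g.continuous) (by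
        rintro _ ⟨z, hz, rfl⟩ q
        exact ⟨hg (.inl q) z hz, hg (.inr q) z hz⟩) hδ hε
      exact ⟨s, hs, fun p hp => hs' _ (mem_image_of_mem g hp.1.1) _ (mem_image_of_mem g hp.1.2)
        (hδ' p hp)⟩)
  refine ⟨g, fun u hu v hv huv => ?_⟩
  by_contra hne
  obtain ⟨n, hn⟩ := exists_nat_one_div_lt (dist_pos.2 hne)
  exact hg n (u, v) ⟨⟨hu, hv⟩, hn.le⟩ huv

/-- The shear `(x, y) ↦ (x, y + f x)`. -/
def ContinuousMap.shear (f : C(ℝ, ℝ)) : ℝ × ℝ ≃ₜ ℝ × ℝ where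
  toFun z := (z.1, z.2 + f z.1)
  invFun z := (z.1, z.2 - f z.1)
  left_inv z := by simp
  right_inv z := by simp
  continuous_toFun := by fun_prop
  continuous_invFun := by fun_prop

theorem ContinuousMap.shear_apply (f : C(ℝ, ℝ)) (z : ℝ × ℝ) : f.shear z = (z.1, z.2 + f z.1) := rfl

theorem exists_homeomorph_flatten {K : Set (ℝ × ℝ)} (hK : IsCompact K)
    (hT : IsTotallyDisconnected K) :
    ∃ g : ℝ × ℝ ≃ₜ ℝ × ℝ, ∀ z ∈ K, (g z).2 = 0 := by
  obtain ⟨g, hg⟩ := exists_homeomorph_injOn_fst hK hT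
  have := isCompact_iff_compactSpace.1 hK
  have he : IsClosedEmbedding fun z : K => (g z).1 :=
    Continuous.isClosedEmbedding (by fun_prop) (injOn_iff_injective.1 hg)
  obtain ⟨f, hf⟩ := ContinuousMap.exists_extension' he (⟨fun z : K => -(g z).2, by fun_prop⟩)
  refine ⟨g.trans f.shear, fun z hz => ?_⟩
  have := congrFun hf ⟨z, hz⟩
  simp only [Function.comp_apply, ContinuousMap.coe_mk] at this
  rw [Homeomorph.trans_apply, ContinuousMap.shear_apply, this]
  simp

/-- Homeomorphisms between compact totally disconnected subsets of the plane extend to the plane. -/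
theorem Homeomorph.exists_extension_plane {K L : Set (ℝ × ℝ)} (hK : IsCompact K)
    (hL : IsCompact L) (hKT : IsTotallyDisconnected K) (hLT : IsTotallyDisconnected L)
    (f : K ≃ₜ L) : ∃ h : ℝ × ℝ ≃ₜ ℝ × ℝ, ∀ z : K, h z = f z := by
  obtain ⟨g, hg⟩ := exists_homeomorph_flatten hK hKT
  obtain ⟨g', hg'⟩ := exists_homeomorph_flatten hL hLT
  have := isCompact_iff_compactSpace.1 hK
  have := isCompact_iff_compactSpace.1 hL
  have he : IsClosedEmbedding fun z : K => (g z).1 :=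
    Continuous.isClosedEmbedding (by fun_prop) fun u v huv => Subtype.ext (g.injective
      (Prod.ext huv ((hg u u.2).trans (hg v v.2).symm)))
  have he' : IsClosedEmbedding fun z : L => (g' z).1 :=
    Continuous.isClosedEmbedding (by fun_prop) fun u v huv => Subtype.ext (g'.injective
      (Prod.ext huv ((hg' u u.2).trans (hg' v v.2).symm)))
  obtain ⟨φ, hφ⟩ := ContinuousMap.exists_extension' he (⟨fun z : K => (g' (f z)).1, by fun_prop⟩)
  obtain ⟨ψ, hψ⟩ := ContinuousMap.exists_extension' he'
    (⟨fun z : L => (g (f.symm z)).1, by fun_prop⟩)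
  refine ⟨(g.trans φ.shear).trans ((Homeomorph.prodComm ℝ ℝ).trans (g'.trans ψ.shear).symm),
    fun z => ?_⟩
  have h1 := congrFun hφ z
  have h2 := congrFun hψ (f z)
  simp only [Function.comp_apply, ContinuousMap.coe_mk, Homeomorph.symm_apply_apply] at h1 h2
  rw [Homeomorph.trans_apply, Homeomorph.trans_apply, Homeomorph.symm_apply_eq]
  simp only [Homeomorph.trans_apply, ContinuousMap.shear_apply, h1, h2, hg z z.2, hg' _ (f z).2,
    Homeomorph.coe_prodComm, Prod.swap_prod_mk, zero_add]

section KnasterReichbach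

variable {X T A C D : Type*} [TopologicalSpace T] [TopologicalSpace A]

/-- Totally disconnected compact metric spaces embed in the Cantor space. -/
theorem exists_injective_nat_bool [MetricSpace X] [CompactSpace X] [TotallyDisconnectedSpace X] :
    ∃ e : X → ℕ → Bool, Continuous e ∧ Function.Injective e := by
  have := TopologicalSpace.Clopens.countable_iff_secondCountable (X := X) |>.2 inferInstance
  obtain ⟨u, hu⟩ := exists_surjective_nat (TopologicalSpace.Clopens X)
  refine ⟨fun x n => (u n : Set X).boolIndicator x, continuous_pi fun n =>
    (continuous_boolIndicator_iff_isClopen _).2 (u n).isClopen, fun x y hxy => ?_⟩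
  by_contra hne
  obtain ⟨U, hU, hx, hy⟩ := exists_isClopen_of_totally_separated hne
  obtain ⟨n, hn⟩ := hu ⟨U, hU⟩
  have h := congrFun hxy n
  simp only [hn, TopologicalSpace.Clopens.coe_mk] at h
  rw [(mem_iff_boolIndicator _ _).1 hx, (notMem_iff_boolIndicator _ _).1 hy] at h
  exact Bool.noConfusion h

theorem Topology.IsClosedEmbedding.exists_continuous_leftInverse [MetricSpace X] [CompactSpace X]
    [TotallyDisconnectedSpace X] [Nonempty T] {i : T → X} (hi : IsClosedEmbedding i) :
    ∃ r : X → T, Continuous r ∧ ∀ t, r (i t) = t := by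
  obtain ⟨e, he, he'⟩ := exists_injective_nat_bool (X := X)
  have hj := (he.isClosedEmbedding he').comp hi
  obtain ⟨ρ, hρ, -, hρc⟩ := PiNat.exists_retraction_subtype_of_isClosed hj.isClosed_range
    (range_nonempty _)
  refine ⟨fun x => hj.isEmbedding.toHomeomorph.symm (ρ (e x)),
    (Homeomorph.continuous _).comp (hρc.comp he), fun t => ?_⟩
  have h := hρ ⟨(e ∘ i) t, mem_range_self t⟩
  simp only [Function.comp_apply] at h
  beta_reduce
  rw [h]
  exact hj.isEmbedding.toHomeomorph_symm_apply t

variable [MetricSpace D] [CompactSpace D] [TotallyDisconnectedSpace D] [PerfectSpace D]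
  [MetricSpace C]

theorem exists_continuous_image_eq_extend {i : A → D} (hi : IsClosedEmbedding i)
    (hint : interior (range i) = ∅) {j : A → C} (hj : Continuous j) {U : Set D} {V : Set C}
    (hU : IsClopen U) (hUne : U.Nonempty) (hV : IsCompact V) (hVne : V.Nonempty)
    (hUV : ∀ a, i a ∈ U → j a ∈ V) :
    ∃ g : D → C, Continuous g ∧ g '' U = V ∧ ∀ a, i a ∈ U → g (i a) = j a := by
  classical
  obtain ⟨p, hpU, hp⟩ : (U \ range i).Nonempty := by
    rw [sdiff_nonempty]
    intro h
    have := interior_mono h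
    rw [hint, hU.isOpen.interior_eq] at this
    exact hUne.ne_empty (subset_empty_iff.1 this)
  obtain ⟨W, hW, hpW, hWU⟩ := compact_exists_isClopen_in_isOpen
    (hU.isOpen.sdiff hi.isClosed_range) ⟨hpU, hp⟩
  have hperf : Perfect W := ⟨hW.isClosed, hW.isOpen.preperfect⟩
  obtain ⟨κ, hκW, hκ, hκi⟩ := hperf.exists_nat_bool_injection ⟨p, hpW⟩
  obtain ⟨r₀, hr₀, hr₀'⟩ := (hκ.isClosedEmbedding hκi).exists_continuous_leftInverse
  have := hVne.to_subtype
  have := isCompact_iff_compactSpace.1 hV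
  obtain ⟨θ, hθ, hθs⟩ := exists_nat_bool_continuous_surjective_of_compact V
  obtain ⟨s, hs, hsV, hsj⟩ : ∃ s : D → C, Continuous s ∧ (∀ x, s x ∈ V) ∧
      ∀ a, i a ∈ U → s (i a) = j a := by
    by_cases hA : Nonempty (i ⁻¹' U)
    · obtain ⟨r, hr, hr'⟩ := (hi.comp
        (hU.isClosed.preimage hi.continuous).isClosedEmbedding_subtypeVal
        ).exists_continuous_leftInverse
      refine ⟨fun x => j (r x), hj.comp (continuous_subtype_val.comp hr), fun x => hUV _ (r x).2,
        fun a ha => ?_⟩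
      have := hr' ⟨a, ha⟩
      simp only [Function.comp_apply] at this
      simp only [this]
    · obtain ⟨v, hv⟩ := hVne
      exact ⟨fun _ => v, continuous_const, fun _ => hv, fun a ha => (hA ⟨⟨a, ha⟩⟩).elim⟩
  refine ⟨W.piecewise (fun x => (θ (r₀ x) : C)) s, ?_, ?_, ?_⟩
  · refine Continuous.piecewise ?_ (by fun_prop) hs
    simp [hW.frontier_eq]
  · apply subset_antisymm
    · rintro _ ⟨x, -, rfl⟩
      by_cases hx : x ∈ W
      · rw [piecewise_eq_of_mem _ _ _ hx]
        exact (θ _).2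
      · rw [piecewise_eq_of_notMem _ _ _ hx]
        exact hsV x
    · intro v hv
      obtain ⟨t, ht⟩ := hθs ⟨v, hv⟩
      have h := hκW (mem_range_self t)
      refine ⟨κ t, (hWU h).1, ?_⟩
      rw [piecewise_eq_of_mem _ _ _ h, hr₀', ht]
  · intro a ha
    rw [piecewise_eq_of_notMem _ _ _ fun h => (hWU h).2 (mem_range_self a), hsj a ha]

variable [CompactSpace C]

theorem exists_continuousMap_surjective_extend {i : A → D} (hi : IsClosedEmbedding i)
    (hint : interior (range i) = ∅) {j : A → C} (hj : Continuous j)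
    {ι : Type*} [TopologicalSpace ι] [DiscreteTopology ι] [Finite ι] {l : D → ι} {m : C → ι}
    (hl : Continuous l) (hm : Continuous m) (hlm : range l = range m)
    (hij : ∀ a, l (i a) = m (j a)) :
    ∃ g : C(D, C), (∀ a, g (i a) = j a) ∧ Function.Surjective g ∧ ∀ x, m (g x) = l x := by
  have key : ∀ k ∈ range l, ∃ g : D → C, Continuous g ∧ g '' (l ⁻¹' {k}) = m ⁻¹' {k} ∧
      ∀ a, i a ∈ l ⁻¹' {k} → g (i a) = j a := fun k hk =>
    exists_continuous_image_eq_extend hi hint hj ((isClopen_discrete _).preimage hl)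
      (preimage_singleton_nonempty.2 hk) (((isClosed_discrete _).preimage hm).isCompact)
      (preimage_singleton_nonempty.2 (hlm ▸ hk)) (fun a ha => by
        simpa only [mem_preimage, mem_singleton_iff, ← hij a] using ha)
  have : ∃ g : ι → D → C, ∀ k ∈ range l, Continuous (g k) ∧ g k '' (l ⁻¹' {k}) = m ⁻¹' {k} ∧
      ∀ a, i a ∈ l ⁻¹' {k} → g k (i a) = j a := by
    choose g hg using fun k : range l => key k k.2
    classical
    by_cases hD : Nonempty D
    · obtain ⟨x⟩ := hD
      refine ⟨fun k => if h : k ∈ range l then g ⟨k, h⟩ else g ⟨l x, mem_range_self x⟩,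
        fun k hk => ?_⟩
      simpa only [hk, dite_true] using hg ⟨k, hk⟩
    · exact ⟨fun k x => (hD ⟨x⟩).elim, fun k ⟨x, _⟩ => (hD ⟨x⟩).elim⟩
  obtain ⟨g, hg⟩ := this
  refine ⟨⟨fun x => g (l x) x, ?_⟩, fun a => (hg _ (mem_range_self _)).2.2 a rfl, fun y => ?_,
    fun x => ?_⟩
  · rw [continuous_iff_continuousAt]
    intro x
    refine ((hg _ (mem_range_self x)).1.continuousAt (x := x)).congr ?_
    filter_upwards [((isOpen_discrete {l x}).preimage hl).mem_nhds rfl] with y hy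
    rw [show l y = l x from hy]
  · have hy : m y ∈ range l := hlm ▸ mem_range_self y
    obtain ⟨x, hx, hxy⟩ := (hg _ hy).2.1.ge (show y ∈ m ⁻¹' {m y} from rfl)
    exact ⟨x, by simpa only [ContinuousMap.coe_mk, show l x = m y from hx] using hxy⟩
  · exact (hg _ (mem_range_self x)).2.1.le (mem_image_of_mem _ rfl)

theorem exists_finite_discrete_map_dist_lt [TotallyDisconnectedSpace C] {ε : ℝ} (hε : 0 < ε) :
    ∃ (n : ℕ) (k : C → Fin n → Bool), Continuous k ∧ ∀ x y, k x = k y → dist x y < ε := by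
  have hS : IsCompact {p : C × C | ε ≤ dist p.1 p.2} :=
    (isClosed_le continuous_const (continuous_fst.dist continuous_snd)).isCompact
  have := TopologicalSpace.Clopens.countable_iff_secondCountable (X := C) |>.2 inferInstance
  obtain ⟨u, hu⟩ := exists_surjective_nat (TopologicalSpace.Clopens C)
  obtain ⟨t, ht⟩ := hS.elim_finite_subcover (fun n => (u n : Set C) ×ˢ (u n : Set C)ᶜ)
    (fun n => (u n).isClopen.isOpen.prod (u n).isClopen.compl.isOpen) (by
      rintro ⟨x, y⟩ h
      obtain ⟨U, hU, hx, hy⟩ := exists_isClopen_of_totally_separated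
        (dist_pos.1 (hε.trans_le h))
      obtain ⟨n, hn⟩ := hu ⟨U, hU⟩
      refine mem_iUnion.2 ⟨n, ?_⟩
      rw [hn]
      exact ⟨hx, hy⟩)
  obtain ⟨N, hN⟩ := t.exists_nat_subset_range
  refine ⟨N, fun x n => (u n : Set C).boolIndicator x, continuous_pi fun n =>
    (continuous_boolIndicator_iff_isClopen _).2 (u n).isClopen, fun x y hxy => ?_⟩
  by_contra! h
  obtain ⟨n, hn, hx, hy⟩ : ∃ n ∈ t, x ∈ (u n : Set C) ∧ y ∉ (u n : Set C) := by
    obtain ⟨n, hn, h⟩ := mem_iUnion₂.1 (ht (show (x, y) ∈ {p : C × C | ε ≤ dist p.1 p.2} from h))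
    exact ⟨n, hn, h⟩
  have h := congrFun hxy ⟨n, Finset.mem_range.1 (hN hn)⟩
  beta_reduce at h
  rw [(mem_iff_boolIndicator _ _).1 hx, (notMem_iff_boolIndicator _ _).1 hy] at h
  exact Bool.noConfusion h

/-- The approximation step: surjections extending `j` can be perturbed to separate a given clopen
set from its complement. -/
theorem exists_dist_lt_disjoint_image [TotallyDisconnectedSpace C] [PerfectSpace C] {i : A → D}
    (hi : IsClosedEmbedding i) (hint : interior (range i) = ∅) {j : A → C}
    (hj : IsClosedEmbedding j) (hjnt : interior (range j) = ∅) {f : D → C} (hf : Continuous f)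
    (hfs : Function.Surjective f) (hfi : ∀ a, f (i a) = j a) {U : Set D} (hU : IsClopen U)
    {ε : ℝ} (hε : 0 < ε) :
    ∃ g : C(D, C), (∀ a, g (i a) = j a) ∧ Function.Surjective g ∧ (∀ x, dist (g x) (f x) < ε) ∧
      ∀ x ∈ U, ∀ y ∈ Uᶜ, g x ≠ g y := by
  obtain ⟨n, k, hk, hkε⟩ := exists_finite_discrete_map_dist_lt (C := C) hε
  have hpq : ∀ v : range k, ∃ p q : C, p ≠ q ∧ p ∉ range j ∧ q ∉ range j ∧ k p = v ∧ k q = v := by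
    intro v
    have ho : IsOpen (k ⁻¹' {(v : Fin n → Bool)} \ range j) :=
      ((isOpen_discrete _).preimage hk).sdiff hj.isClosed_range
    obtain ⟨p, hp⟩ : (k ⁻¹' {(v : Fin n → Bool)} \ range j).Nonempty := by
      rw [sdiff_nonempty]
      intro h
      have := interior_mono h
      rw [hjnt, ((isOpen_discrete _).preimage hk).interior_eq] at this
      exact (preimage_singleton_nonempty.2 v.2).ne_empty (subset_empty_iff.1 this)
    obtain ⟨q, hq, hqp⟩ := preperfect_iff_nhds.1 (PerfectSpace.univ_preperfect (α := C)) p trivial _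
      (ho.mem_nhds hp)
    exact ⟨p, q, hqp.symm, hp.2, hq.1.2, hp.1, hq.1.1⟩
  choose p q hpq hpj hqj hkp hkq using hpq
  set J₁ : Set (Fin n → Bool) := (fun x => k (f x)) '' U with hJ₁
  set J₂ : Set (Fin n → Bool) := (fun x => k (f x)) '' Uᶜ with hJ₂
  have hJ : ∀ y, k y ∈ J₁ ∨ k y ∈ J₂ := by
    intro y
    obtain ⟨x, rfl⟩ := hfs y
    by_cases hx : x ∈ U
    · exact .inl ⟨x, hx, rfl⟩
    · exact .inr ⟨x, hx, rfl⟩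
  set P : Set C := j '' (i ⁻¹' U) ∪ p '' {v | (v : Fin n → Bool) ∈ J₁} ∪ k ⁻¹' J₂ᶜ with hP
  set Q : Set C := j '' (i ⁻¹' Uᶜ) ∪ q '' {v | (v : Fin n → Bool) ∈ J₂} ∪ k ⁻¹' J₁ᶜ with hQ
  have hPc : IsClosed P := ((hj.isClosedMap _ (hU.isClosed.preimage hi.continuous)).union
    ((Set.toFinite _).image _).isClosed).union ((isClosed_discrete _).preimage hk)
  have hQc : IsClosed Q := ((hj.isClosedMap _ (hU.compl.isClosed.preimage hi.continuous)).union
    ((Set.toFinite _).image _).isClosed).union ((isClosed_discrete _).preimage hk)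
  have hPQ : P ⊆ Qᶜ := by
    rintro y ((⟨a, ha, rfl⟩ | ⟨v, hv, rfl⟩) | hy) ((⟨b, hb, hab⟩ | ⟨w, hw, hvw⟩) | hy')
    · exact hb (hj.injective hab ▸ ha)
    · exact hqj w ⟨a, hvw.symm⟩
    · exact hy' ⟨i a, ha, congrArg k (hfi a)⟩
    · exact hpj v ⟨b, hab⟩
    · have : v = w := Subtype.ext (by rw [← hkp v, ← hvw, hkq w])
      exact hpq v (this ▸ hvw.symm)
    · exact hy' ((hkp v).symm ▸ hv)
    · exact hy ⟨i b, hb, by rw [← hab, ← hfi b]⟩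
    · exact hy (hvw ▸ (hkq w).symm ▸ hw)
    · exact (hJ y).elim hy' hy
  obtain ⟨V, hV, hPV, hVQ⟩ := exists_clopen_of_closed_subset_open hPc hQc.isOpen_compl hPQ
  have hrange : range (fun x => (k (f x), U.boolIndicator x)) =
      range (fun y => (k y, V.boolIndicator y)) := by
    apply subset_antisymm
    · rintro _ ⟨x, rfl⟩
      have hx := mem_range_self (f := k) (f x)
      by_cases hxU : x ∈ U
      · refine ⟨p ⟨_, hx⟩, Prod.ext (hkp _) ?_⟩
        have hpV : p ⟨_, hx⟩ ∈ V := hPV (.inl (.inr ⟨_, ⟨x, hxU, rfl⟩, rfl⟩))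
        exact ((mem_iff_boolIndicator _ _).1 hpV).trans ((mem_iff_boolIndicator _ _).1 hxU).symm
      · refine ⟨q ⟨_, hx⟩, Prod.ext (hkq _) ?_⟩
        have hqV : q ⟨_, hx⟩ ∉ V := fun h => hVQ h (.inl (.inr ⟨_, ⟨x, hxU, rfl⟩, rfl⟩))
        exact ((notMem_iff_boolIndicator _ _).1 hqV).trans
          ((notMem_iff_boolIndicator _ _).1 hxU).symm
    · rintro _ ⟨y, rfl⟩
      by_cases hyV : y ∈ V
      · obtain ⟨x, hx, hxy⟩ : k y ∈ J₁ := by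
          by_contra h
          exact hVQ hyV (.inr h)
        exact ⟨x, Prod.ext hxy (((mem_iff_boolIndicator _ _).1 hx).trans
          ((mem_iff_boolIndicator _ _).1 hyV).symm)⟩
      · obtain ⟨x, hx, hxy⟩ : k y ∈ J₂ := by
          by_contra h
          exact hyV (hPV (.inr h))
        exact ⟨x, Prod.ext hxy (((notMem_iff_boolIndicator _ _).1 hx).trans
          ((notMem_iff_boolIndicator _ _).1 hyV).symm)⟩
  obtain ⟨g, hgi, hgs, hg⟩ := exists_continuousMap_surjective_extend hi hint hj.continuous
    (l := fun x => (k (f x), U.boolIndicator x)) (m := fun y => (k y, V.boolIndicator y))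
    ((hk.comp hf).prodMk ((continuous_boolIndicator_iff_isClopen _).2 hU))
    (hk.prodMk ((continuous_boolIndicator_iff_isClopen _).2 hV)) hrange (fun a => by
      refine Prod.ext (congrArg k (hfi a)) ?_
      by_cases ha : i a ∈ U
      · have h : j a ∈ V := hPV (.inl (.inl ⟨a, ha, rfl⟩))
        exact ((mem_iff_boolIndicator _ _).1 ha).trans ((mem_iff_boolIndicator _ _).1 h).symm
      · have h : j a ∉ V := fun h => hVQ h (.inl (.inl ⟨a, ha, rfl⟩))
        exact ((notMem_iff_boolIndicator _ _).1 ha).trans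
          ((notMem_iff_boolIndicator _ _).1 h).symm)
  refine ⟨g, hgi, hgs, fun x => hkε _ _ (Prod.ext_iff.1 (hg x)).1, fun x hx y hy hxy => ?_⟩
  have h := (Prod.ext_iff.1 (hg x)).2.symm.trans
    ((congrArg V.boolIndicator hxy).trans (Prod.ext_iff.1 (hg y)).2)
  dsimp only at h
  rw [(mem_iff_boolIndicator _ _).1 hx, (notMem_iff_boolIndicator _ _).1 hy] at h
  exact Bool.noConfusion h

/-- Knaster–Reichbach: two Cantor sets containing `A` as a nowhere dense closed subset are
homeomorphic by a homeomorphism fixing `A`. -/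
theorem exists_homeomorph_eq_on_nowhereDense [TotallyDisconnectedSpace C] [PerfectSpace C]
    [Nonempty C] [Nonempty D] {i : A → D} (hi : IsClosedEmbedding i)
    (hint : interior (range i) = ∅) {j : A → C} (hj : IsClosedEmbedding j)
    (hjnt : interior (range j) = ∅) : ∃ h : D ≃ₜ C, ∀ a, h (i a) = j a := by
  set S : Set C(D, C) := {f | (∀ a, f (i a) = j a) ∧ Function.Surjective f} with hS
  have hSc : IsClosed S := by
    refine IsClosed.inter (s₁ := {f : C(D, C) | ∀ a, f (i a) = j a})
      (s₂ := {f : C(D, C) | Function.Surjective f}) ?_ ?_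
    · simp only [ofPred_forall]
      exact isClosed_iInter fun a => isClosed_eq (continuous_eval_const _) continuous_const
    · simp only [Function.Surjective, ofPred_forall]
      refine isClosed_iInter fun y => ⟨?_⟩
      convert isCompact_univ.isOpen_forall_mem (S := (univ : Set D))
        (U := {p : C(D, C) × D | p.1 p.2 ≠ y}) (isOpen_ne_fun (by fun_prop) continuous_const)
        using 1
      ext f
      simp
  have := hSc.isComplete.completeSpace_coe
  obtain ⟨g₀, hg₀, hg₀s, -⟩ := exists_continuousMap_surjective_extend hi hint hj.continuous
    (l := fun _ : D => ()) (m := fun _ : C => ()) continuous_const continuous_const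
    (by simp) (fun _ => rfl)
  have := TopologicalSpace.Clopens.countable_iff_secondCountable (X := D) |>.2 inferInstance
  have hdense : Dense (⋂ U : TopologicalSpace.Clopens D,
      {f : S | ∀ x ∈ (U : Set D) ×ˢ (U : Set D)ᶜ, (f : C(D, C)) x.1 ≠ (f : C(D, C)) x.2}) := by
    apply dense_iInter_of_isOpen
    · intro U
      exact ((U.isClopen.isClosed.isCompact.prod
        U.isClopen.compl.isClosed.isCompact).isOpen_forall_mem
        (U := {p : C(D, C) × (D × D) | p.1 p.2.1 ≠ p.1 p.2.2})
        (isOpen_ne_fun (by fun_prop) (by fun_prop))).preimage continuous_subtype_val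
    · intro U
      rw [Metric.dense_iff]
      rintro ⟨f, hfi, hfs⟩ ε hε
      obtain ⟨g, hgi, hgs, hgf, hgU⟩ := exists_dist_lt_disjoint_image hi hint hj hjnt f.continuous
        hfs hfi U.isClopen hε
      refine ⟨⟨g, hgi, hgs⟩, ?_, fun x hx => hgU _ hx.1 _ hx.2⟩
      rw [Metric.mem_ball, Subtype.dist_eq]
      exact (ContinuousMap.dist_lt_iff hε).2 hgf
  have : Nonempty S := ⟨⟨g₀, hg₀, hg₀s⟩⟩
  obtain ⟨⟨f, hfi, hfs⟩, hf⟩ := hdense.nonempty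
  have hinj : Function.Injective f := by
    intro x y hxy
    by_contra hne
    obtain ⟨U, hU, hx, hy⟩ := exists_isClopen_of_totally_separated hne
    exact mem_iInter.1 hf ⟨U, hU⟩ (x, y) ⟨hx, hy⟩ hxy
  exact ⟨f.continuous.homeoOfEquivCompactToT2 (f := Equiv.ofBijective f ⟨hinj, hfs⟩), hfi⟩

end KnasterReichbach

theorem Perfect.perfectSpace {X : Type*} [TopologicalSpace X] {s : Set X} (hs : Perfect s) :
    PerfectSpace s := by
  refine ⟨preperfect_iff_nhds.2 fun x _ U hU => ?_⟩
  obtain ⟨V, hV, hVU⟩ := mem_nhds_subtype s x U |>.1 hU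
  obtain ⟨y, hy, hyx⟩ := preperfect_iff_nhds.1 hs.acc x x.2 V hV
  exact ⟨⟨y, hy.2⟩, ⟨hVU hy.1, trivial⟩, fun h => hyx (congrArg Subtype.val h)⟩

/-- Two compact perfect totally disconnected sets containing `a` as a nowhere dense subset are
homeomorphic by a homeomorphism fixing `a`. -/
theorem exists_homeomorph_subtype_fixing {X : Type*} [MetricSpace X] {a c d : Set X}
    (hac : IsCompact a) (hcc : IsCompact c) (hcP : Perfect c) (hcne : c.Nonempty)
    (hcT : IsTotallyDisconnected c) (hdc : IsCompact d) (hdP : Perfect d) (hdne : d.Nonempty)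
    (hdT : IsTotallyDisconnected d) (hsubc : a ⊆ c) (hsubd : a ⊆ d)
    (hacN : interior {x : ↥c | (x : X) ∈ a} = ∅) (hadN : interior {x : ↥d | (x : X) ∈ a} = ∅) :
    ∃ h : d ≃ₜ c, ∀ x (hx : x ∈ a), (h ⟨x, hsubd hx⟩ : X) = x := by
  have := isCompact_iff_compactSpace.1 hac
  have := isCompact_iff_compactSpace.1 hcc
  have := isCompact_iff_compactSpace.1 hdc
  have := totallyDisconnectedSpace_subtype_iff.2 hcT
  have := totallyDisconnectedSpace_subtype_iff.2 hdT
  have := hcP.perfectSpace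
  have := hdP.perfectSpace
  have := hcne.to_subtype
  have := hdne.to_subtype
  obtain ⟨h, hh⟩ := exists_homeomorph_eq_on_nowhereDense (D := d) (C := c)
    ((continuous_inclusion hsubd).isClosedEmbedding (inclusion_injective hsubd))
    (by rwa [range_inclusion])
    ((continuous_inclusion hsubc).isClosedEmbedding (inclusion_injective hsubc))
    (by rwa [range_inclusion])
  exact ⟨h, fun x hx => congrArg Subtype.val (hh ⟨x, hx⟩)⟩

theorem Homeomorph.exists_extension_of_homeomorph_prod {E : Type*} [TopologicalSpace E]
    (φ : E ≃ₜ ℝ × ℝ) {K L : Set E} (hK : IsCompact K) (hL : IsCompact L)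
    (hKT : IsTotallyDisconnected K) (hLT : IsTotallyDisconnected L) (f : K ≃ₜ L) :
    ∃ h : E ≃ₜ E, ∀ z : K, h z = f z := by
  obtain ⟨h, hh⟩ := Homeomorph.exists_extension_plane (hK.image φ.continuous)
    (hL.image φ.continuous) (φ.isEmbedding.isTotallyDisconnected_image.2 hKT)
    (φ.isEmbedding.isTotallyDisconnected_image.2 hLT)
    (((φ.image K).symm.trans f).trans (φ.image L))
  refine ⟨(φ.trans h).trans φ.symm, fun z => ?_⟩
  have h1 := hh (φ.image K z)
  simp only [Homeomorph.trans_apply, Homeomorph.symm_apply_apply] at h1 ⊢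
  rw [Homeomorph.symm_apply_eq]
  exact h1

end PlaneHomeomorphisms

/-- In the plane, if `a` is compact totally disconnected and is
a nowhere dense subset of two nonempty compact perfect totally disconnected
sets `c`, `d`, then there is a self-homeomorphism of the plane fixing `a`
pointwise and mapping `d` onto `c`. -/
theorem stmt17 (a c d : Set (EuclideanSpace ℝ (Fin 2)))
    (hac : IsCompact a) (haT : IsTotallyDisconnected a)
    (hcc : IsCompact c) (hcP : Perfect c) (hcne : c.Nonempty)
    (hcT : IsTotallyDisconnected c)
    (hdc : IsCompact d) (hdP : Perfect d) (hdne : d.Nonempty)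
    (hdT : IsTotallyDisconnected d)
    (hsubc : a ⊆ c) (hsubd : a ⊆ d)
    (hacN : interior {x : ↥c | (x : EuclideanSpace ℝ (Fin 2)) ∈ a} = ∅)
    (hadN : interior {x : ↥d | (x : EuclideanSpace ℝ (Fin 2)) ∈ a} = ∅) :
    ∃ h : EuclideanSpace ℝ (Fin 2) ≃ₜ EuclideanSpace ℝ (Fin 2),
      (∀ x ∈ a, h x = x) ∧ h '' d = c := by
  obtain ⟨f, hf⟩ := exists_homeomorph_subtype_fixing hac hcc hcP hcne hcT hdc hdP hdne hdT hsubc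
    hsubd hacN hadN
  obtain ⟨h, hh⟩ := Homeomorph.exists_extension_of_homeomorph_prod
    ((EuclideanSpace.equiv (Fin 2) ℝ).toHomeomorph.trans Homeomorph.finTwoArrow) hdc hcc hdT hcT f
  refine ⟨h, fun x hx => (hh ⟨x, hsubd hx⟩).trans (hf x hx), Set.Subset.antisymm ?_ fun y hy => ?_⟩
  · rintro _ ⟨x, hx, rfl⟩
    exact hh ⟨x, hx⟩ ▸ (f ⟨x, hx⟩).2
  · exact ⟨f.symm ⟨y, hy⟩, (f.symm _).2, by rw [hh, f.apply_symm_apply]⟩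
end

section
/- Let n ≥ 1, let a ⊆ ℝⁿ be a set whose closure is countable and compact, and let (b_i)_{i∈ℕ} be a sequence of subsets of ℝⁿ each of whose closures is countable and compact. Then there exist self-homeomorphisms h_i of ℝⁿ, each satisfying h_i x = x for all x ∈ a, such that the closure of ⋃_{i∈ℕ} h_i '' b_i is countable and compact. -/
open Set Filter Topology Metric
open scoped NNReal

section RadialContraction

variable {E : Type*} [NormedAddCommGroup E]

/-- A nonnegative speed supported in the ball of radius `R`, vanishing exactly on the
closed `r`-thickening of `A` inside this ball. -/
noncomputable def radialSpeed (A : Set E) (r R : ℝ) (w : E) : ℝ :=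
  min (max (infDist w A - r) 0) (max (R - ‖w‖) 0)

theorem radialSpeed_nonneg (A : Set E) (r R : ℝ) (w : E) : 0 ≤ radialSpeed A r R w :=
  le_min (le_max_right _ _) (le_max_right _ _)

theorem radialSpeed_le {R : ℝ} (hR : 0 ≤ R) (A : Set E) (r : ℝ) (w : E) :
    radialSpeed A r R w ≤ R :=
  (min_le_right _ _).trans (max_le (by linarith [norm_nonneg w]) hR)

theorem radialSpeed_div_mem {R : ℝ} (hR : 0 < R) (A : Set E) (r : ℝ) (w : E) :
    0 ≤ radialSpeed A r R w / (4 * R) ∧ radialSpeed A r R w / (4 * R) ≤ 1 := by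
  refine ⟨div_nonneg (radialSpeed_nonneg ..) (by positivity), ?_⟩
  rw [div_le_one (by positivity)]
  linarith [radialSpeed_le hR.le A r w]

theorem radialSpeed_eq_zero_of_le_norm {R : ℝ} {w : E} (hw : R ≤ ‖w‖) (A : Set E) (r : ℝ) :
    radialSpeed A r R w = 0 :=
  le_antisymm ((min_le_right _ _).trans (max_le (by linarith) le_rfl)) (radialSpeed_nonneg ..)

theorem radialSpeed_eq_zero_of_infDist_le {A : Set E} {r : ℝ} {w : E} (hw : infDist w A ≤ r)
    (R : ℝ) : radialSpeed A r R w = 0 :=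
  le_antisymm ((min_le_left _ _).trans (max_le (by linarith) le_rfl)) (radialSpeed_nonneg ..)

theorem radialSpeed_lipschitz (A : Set E) (r R : ℝ) :
    LipschitzWith 1 (radialSpeed A r R) := by
  have h1 : LipschitzWith 1 fun w : E => infDist w A - r := by
    simpa using (lipschitz_infDist_pt A).sub (LipschitzWith.const' (K := 0) r)
  have h2 : LipschitzWith 1 fun w : E => R - ‖w‖ := by
    simpa using (LipschitzWith.const' (K := 0) R).sub (lipschitzWith_one_norm (E := E))
  have h3 := (h1.max_const 0).min (h2.max_const 0)
  rwa [max_self] at h3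

theorem continuous_radialSpeed (A : Set E) (r R : ℝ) : Continuous (radialSpeed A r R) :=
  (radialSpeed_lipschitz A r R).continuous

theorem abs_radialSpeed_sub_le (A : Set E) (r R : ℝ) (x y : E) :
    |radialSpeed A r R x - radialSpeed A r R y| ≤ ‖x - y‖ := by
  simpa [Real.dist_eq, dist_eq_norm] using (radialSpeed_lipschitz A r R).dist_le_mul x y

variable [NormedSpace ℝ E]

/-- Radial contraction towards the origin with speed `radialSpeed A r R`. -/
noncomputable def radialContraction (A : Set E) (r R : ℝ) (w : E) : E :=
  (1 - radialSpeed A r R w / (4 * R)) • w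

theorem norm_radialSpeed_smul_sub_le {R : ℝ} (hR : 0 ≤ R) (A : Set E) (r : ℝ) (x y : E) :
    ‖radialSpeed A r R x • x - radialSpeed A r R y • y‖ ≤ 2 * R * ‖x - y‖ := by
  have key : ∀ x y : E, ‖y‖ ≤ R →
      ‖radialSpeed A r R x • x - radialSpeed A r R y • y‖ ≤ 2 * R * ‖x - y‖ := by
    intro x y hy
    have e : radialSpeed A r R x • x - radialSpeed A r R y • y =
        radialSpeed A r R x • (x - y) + (radialSpeed A r R x - radialSpeed A r R y) • y := by
      rw [smul_sub, sub_smul]; abel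
    rw [e]
    refine (norm_add_le _ _).trans ?_
    rw [norm_smul, norm_smul, Real.norm_eq_abs, Real.norm_eq_abs,
      abs_of_nonneg (radialSpeed_nonneg ..)]
    have h1 := mul_le_mul_of_nonneg_right (radialSpeed_le hR A r x) (norm_nonneg (x - y))
    have h2 := mul_le_mul (abs_radialSpeed_sub_le A r R x y) hy (norm_nonneg y)
      (norm_nonneg (x - y))
    linarith
  rcases le_total ‖y‖ R with hy | hy
  · exact key x y hy
  rcases le_total ‖x‖ R with hx | hx
  · rw [norm_sub_rev, norm_sub_rev x]
    exact key y x hx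
  · rw [radialSpeed_eq_zero_of_le_norm hx, radialSpeed_eq_zero_of_le_norm hy]
    simp only [zero_smul, sub_zero, norm_zero]
    positivity

theorem exists_homeomorph_eq_radialContraction [CompleteSpace E] {R : ℝ} (hR : 0 < R)
    (A : Set E) (r : ℝ) : ∃ g : E ≃ₜ E, ⇑g = radialContraction A r R := by
  have happ : ApproximatesLinearOn (radialContraction A r R)
      ((ContinuousLinearEquiv.refl ℝ E : E ≃L[ℝ] E) : E →L[ℝ] E) univ (1 / 2 : ℝ≥0) := by
    intro x _ y _
    have e : radialContraction A r R x - radialContraction A r R y -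
        ((ContinuousLinearEquiv.refl ℝ E : E ≃L[ℝ] E) : E →L[ℝ] E) (x - y) =
        -((4 * R)⁻¹ • (radialSpeed A r R x • x - radialSpeed A r R y • y)) := by
      simp only [radialContraction, ContinuousLinearEquiv.coe_coe,
        ContinuousLinearEquiv.refl_apply, sub_smul, one_smul, smul_sub, smul_smul,
        div_eq_inv_mul]
      abel
    rw [e, norm_neg, norm_smul, Real.norm_eq_abs, abs_of_pos (by positivity)]
    have := norm_radialSpeed_smul_sub_le hR.le A r x y
    calc (4 * R)⁻¹ * _ ≤ (4 * R)⁻¹ * (2 * R * ‖x - y‖) := by gcongr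
      _ = _ := by push_cast; field_simp; norm_num
  refine ⟨happ.toHomeomorph _ ?_, rfl⟩
  rcases subsingleton_or_nontrivial E with h | h
  · exact Or.inl h
  · right
    have : ‖((ContinuousLinearEquiv.refl ℝ E).symm : E →L[ℝ] E)‖₊ = 1 := by
      ext
      exact ContinuousLinearMap.norm_id
    rw [this]
    rw [inv_one, ← NNReal.coe_lt_coe]
    norm_num

/-- The scaling factor by which the `k`-th iterate of `radialContraction A r R` moves a point. -/
noncomputable def radialFactor (A : Set E) (r R : ℝ) : ℕ → E → ℝ
  | 0, _ => 1
  | k + 1, x => radialFactor A r R k x *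
      (1 - radialSpeed A r R (radialFactor A r R k x • x) / (4 * R))

theorem radialContraction_iterate (A : Set E) (r R : ℝ) (k : ℕ) (x : E) :
    (radialContraction A r R)^[k] x = radialFactor A r R k x • x := by
  induction k with
  | zero => simp [radialFactor]
  | succ k ih =>
    rw [Function.iterate_succ_apply', ih, radialContraction, smul_smul, radialFactor, mul_comm]

theorem continuous_radialFactor (A : Set E) (r R : ℝ) (k : ℕ) :
    Continuous (radialFactor A r R k) := by
  induction k with
  | zero => exact continuous_const
  | succ k ih =>
    exact ih.mul (continuous_const.sub
      (((continuous_radialSpeed A r R).comp (ih.smul continuous_id)).div_const _))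

theorem radialFactor_nonneg {R : ℝ} (hR : 0 < R) (A : Set E) (r : ℝ) (k : ℕ) (x : E) :
    0 ≤ radialFactor A r R k x := by
  induction k with
  | zero => exact zero_le_one
  | succ k ih => exact mul_nonneg ih (by linarith [(radialSpeed_div_mem hR A r
      (radialFactor A r R k x • x)).2])

theorem radialFactor_antitone {R : ℝ} (hR : 0 < R) (A : Set E) (r : ℝ) (x : E) :
    Antitone fun k => radialFactor A r R k x :=
  antitone_nat_of_succ_le fun k => mul_le_of_le_one_right (radialFactor_nonneg hR A r k x)
    (by linarith [(radialSpeed_div_mem hR A r (radialFactor A r R k x • x)).1])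

/-- Points of the `r`-thickening of `A` are barriers for the radial contraction. -/
theorem le_radialFactor {A : Set E} {r R : ℝ} (hR : 0 < R) {x : E} {μ : ℝ} (hμ : μ ≤ 1)
    (h : infDist (μ • x) A ≤ r) (k : ℕ) : μ ≤ radialFactor A r R k x := by
  induction k with
  | zero => exact hμ
  | succ k ih =>
    rw [radialFactor]
    set ν := radialFactor A r R k x with hν
    have hν0 : 0 ≤ ν := radialFactor_nonneg hR A r k x
    rcases le_total R ‖ν • x‖ with h1 | h1
    · rw [radialSpeed_eq_zero_of_le_norm h1]; simpa using ih
    have h2 := abs_radialSpeed_sub_le A r R (ν • x) (μ • x)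
    rw [radialSpeed_eq_zero_of_infDist_le h, sub_zero, abs_of_nonneg (radialSpeed_nonneg ..),
      ← sub_smul, norm_smul, Real.norm_eq_abs, abs_of_nonneg (by linarith)] at h2
    rw [norm_smul, Real.norm_eq_abs, abs_of_nonneg hν0] at h1
    have h3 : ν * (radialSpeed A r R (ν • x) / (4 * R)) ≤ ν - μ := by
      rw [← mul_div_assoc, div_le_iff₀ (by positivity)]
      have h4 := mul_le_mul_of_nonneg_left h2 hν0
      have h5 := mul_le_mul_of_nonneg_left h1 (sub_nonneg.2 ih)
      have h6 := mul_nonneg (sub_nonneg.2 ih) hR.le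
      nlinarith
    linarith

theorem exists_tendsto_radialFactor {A : Set E} {r R : ℝ} (hR : 0 < R) (h0 : (0 : E) ∈ A)
    (hr : 0 < r) {x : E} (hx : ‖x‖ < R) :
    ∃ l, 0 ≤ l ∧ l ≤ 1 ∧ Tendsto (fun k => radialFactor A r R k x) atTop (𝓝 l) ∧
      infDist (l • x) A ≤ r := by
  have hb : BddBelow (range fun k => radialFactor A r R k x) :=
    ⟨0, by rintro _ ⟨k, rfl⟩; exact radialFactor_nonneg hR A r k x⟩
  have ht := tendsto_atTop_ciInf (radialFactor_antitone hR A r x) hb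
  set l := ⨅ k, radialFactor A r R k x
  have hl0 : 0 ≤ l := ge_of_tendsto' ht fun k => radialFactor_nonneg hR A r k x
  have hl1 : l ≤ 1 := le_of_tendsto' ht fun k => radialFactor_antitone hR A r x (Nat.zero_le k)
  refine ⟨l, hl0, hl1, ht, ?_⟩
  have hlim : l = l * (1 - radialSpeed A r R (l • x) / (4 * R)) := by
    refine tendsto_nhds_unique ((tendsto_add_atTop_iff_nat 1).2 ht) ?_
    have hc : Continuous fun t : ℝ => t * (1 - radialSpeed A r R (t • x) / (4 * R)) :=
      continuous_id.mul (continuous_const.sub (((continuous_radialSpeed A r R).comp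
        (continuous_id.smul continuous_const)).div_const _))
    exact (hc.tendsto l).comp ht
  rcases hl0.eq_or_lt with h | h
  · rw [← h, zero_smul, infDist_zero_of_mem h0]; exact hr.le
  · have hz : radialSpeed A r R (l • x) / (4 * R) = 0 := by
      have : l * (radialSpeed A r R (l • x) / (4 * R)) = 0 := by linarith
      exact (mul_eq_zero.1 this).resolve_left h.ne'
    rw [div_eq_zero_iff, or_iff_left (by positivity)] at hz
    by_contra! hcon
    have hn : ‖l • x‖ < R := by
      rw [norm_smul, Real.norm_eq_abs, abs_of_pos h]
      exact (mul_le_of_le_one_left (norm_nonneg x) hl1).trans_lt hx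
    have : 0 < radialSpeed A r R (l • x) :=
      lt_min (lt_max_of_lt_left (by linarith)) (lt_max_of_lt_left (by linarith))
    linarith

/-- If `r` is not the minimum of the distance to `A` on any rational end piece of the segment
from `0` to `x`, then points near `x` uniformly end up close to `A`. -/
theorem exists_nhds_radialFactor {A : Set E} {r R ε : ℝ} (hR : 0 < R) (h0 : (0 : E) ∈ A)
    (hr : 0 < r) (hrε : r < ε) {x : E} (hx : ‖x‖ < R)
    (hgen : ∀ q : ℚ, sInf ((fun t : ℝ => infDist (t • x) A) '' Icc (q : ℝ) 1) ≠ r) :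
    ∃ U ∈ 𝓝 x, ∃ k₀, ∀ k ≥ k₀, ∀ y ∈ U, infDist (radialFactor A r R k y • y) A < ε := by
  obtain ⟨l, hl0, hl1, ht, hlr⟩ := exists_tendsto_radialFactor (A := A) hR h0 hr hx
  have hF : Continuous fun z : E × ℝ => infDist (z.2 • z.1) A :=
    (continuous_infDist_pt A).comp (continuous_snd.smul continuous_fst)
  have hev : ∀ᶠ z : E × ℝ in 𝓝 (x, l), infDist (z.2 • z.1) A < ε :=
    hF.continuousAt.eventually_lt continuousAt_const (hlr.trans_lt hrε)
  obtain ⟨δ, hδ, hball⟩ := Metric.eventually_nhds_iff.1 hev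
  obtain ⟨μ, hμ0, hμl, hμδ, hμr⟩ :
      ∃ μ, 0 ≤ μ ∧ μ ≤ l ∧ l - δ < μ ∧ infDist (μ • x) A < r := by
    rcases hl0.eq_or_lt with h | h
    · refine ⟨0, le_rfl, hl0, by linarith, ?_⟩
      rw [zero_smul, infDist_zero_of_mem h0]; exact hr
    by_contra! hcon
    obtain ⟨q, hq1, hq2⟩ := exists_rat_btwn (max_lt h (sub_lt_self l hδ))
    have hq0 : (0 : ℝ) < q := (le_max_left _ _).trans_lt hq1
    have hqδ : l - δ < q := (le_max_right _ _).trans_lt hq1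
    refine hgen q (IsLeast.csInf_eq ⟨⟨l, ⟨hq2.le, hl1⟩, ?_⟩, ?_⟩)
    · exact le_antisymm hlr (hcon l hl0 le_rfl (by linarith))
    · rintro _ ⟨t, ⟨htq, ht1⟩, rfl⟩
      rcases le_or_gt t l with h1 | h1
      · exact hcon t (by linarith) h1 (by linarith)
      · by_contra! h2
        have : t ≤ l := ge_of_tendsto' ht fun k => le_radialFactor hR ht1 h2.le k
        linarith
  obtain ⟨k₀, hk₀⟩ := (ht.eventually_lt_const (show l < l + δ by linarith)).exists
  have e1 : ∀ᶠ y in 𝓝 x, infDist (μ • y) A < r :=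
    ((continuous_infDist_pt A).comp (continuous_const_smul μ)).continuousAt.eventually_lt
      continuousAt_const hμr
  have e2 : ∀ᶠ y in 𝓝 x, radialFactor A r R k₀ y < l + δ :=
    (continuous_radialFactor A r R k₀).continuousAt.eventually_lt continuousAt_const hk₀
  refine ⟨_, e1.and (e2.and (Metric.ball_mem_nhds x hδ)), k₀, ?_⟩
  rintro k hk y ⟨h1, h2, h3⟩
  refine hball (y := (y, radialFactor A r R k y)) ?_
  have h4 := le_radialFactor hR (hμl.trans hl1) h1.le k
  have h5 : radialFactor A r R k y ≤ radialFactor A r R k₀ y := radialFactor_antitone hR A r y hk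
  rw [Prod.dist_eq, max_lt_iff, Real.dist_eq, abs_lt]
  exact ⟨h3, by dsimp only; linarith, by dsimp only; linarith⟩

/-- A countable compact set can be pushed into any neighbourhood of a set `A` containing the
origin by a homeomorphism fixing `A` pointwise. -/
theorem exists_homeomorph_fixing_infDist_lt [CompleteSpace E] {A B : Set E} (h0 : (0 : E) ∈ A)
    (hB : IsCompact B) (hBc : B.Countable) {ε : ℝ} (hε : 0 < ε) :
    ∃ h : E ≃ₜ E, (∀ x ∈ A, h x = x) ∧ ∀ x ∈ B, infDist (h x) A < ε := by
  obtain ⟨R, hR, hBR⟩ : ∃ R > 0, ∀ x ∈ B, ‖x‖ < R := by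
    obtain ⟨R, hR, h⟩ := hB.isBounded.exists_pos_norm_lt
    exact ⟨R, hR, h⟩
  have hbad : (⋃ x ∈ B, range fun q : ℚ =>
      sInf ((fun t : ℝ => infDist (t • x) A) '' Icc (q : ℝ) 1)).Countable :=
    hBc.biUnion fun x _ => countable_range _
  obtain ⟨r, ⟨hr, hrε⟩, hrbad⟩ : ∃ r ∈ Ioo 0 ε, r ∉ ⋃ x ∈ B, range fun q : ℚ =>
      sInf ((fun t : ℝ => infDist (t • x) A) '' Icc (q : ℝ) 1) := by
    by_contra! hcon
    exact (Cardinal.Real.Ioo_countable_iff.1 (hbad.mono hcon)).not_gt hε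
  simp only [mem_iUnion, mem_range, not_exists] at hrbad
  obtain ⟨g, hg⟩ := exists_homeomorph_eq_radialContraction hR A r
  have hiter : ∀ k : ℕ, ∃ h : E ≃ₜ E, ⇑h = (radialContraction A r R)^[k] := by
    intro k
    induction k with
    | zero => exact ⟨Homeomorph.refl E, rfl⟩
    | succ k ih =>
      obtain ⟨h, hh⟩ := ih
      refine ⟨g.trans h, ?_⟩
      rw [Function.iterate_succ, ← hh, ← hg]
      rfl
  obtain ⟨k₀, hk₀⟩ : ∃ k₀, ∀ k ≥ k₀, ∀ y ∈ B, infDist (radialFactor A r R k y • y) A < ε := by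
    refine hB.induction_on
      (p := fun S => ∃ k₀, ∀ k ≥ k₀, ∀ y ∈ S, infDist (radialFactor A r R k y • y) A < ε)
      ⟨0, by simp⟩ ?_ ?_ ?_
    · rintro s t hst ⟨k₀, h⟩
      exact ⟨k₀, fun k hk y hy => h k hk y (hst hy)⟩
    · rintro s t ⟨k₀, h⟩ ⟨k₁, h'⟩
      refine ⟨max k₀ k₁, fun k hk y hy => hy.elim ?_ ?_⟩
      · exact h k (le_of_max_le_left hk) y
      · exact h' k (le_of_max_le_right hk) y
    · intro x hx
      obtain ⟨U, hU, h⟩ := exists_nhds_radialFactor (A := A) hR h0 hr hrε (hBR x hx)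
        (hrbad x hx)
      exact ⟨U, mem_nhdsWithin_of_mem_nhds hU, h⟩
  obtain ⟨h, hh⟩ := hiter k₀
  refine ⟨h, fun x hx => ?_, fun x hx => ?_⟩
  · rw [hh]
    refine Function.iterate_fixed ?_ k₀
    rw [radialContraction, radialSpeed_eq_zero_of_infDist_le
      ((infDist_zero_of_mem hx).trans_le hr.le)]
    simp
  · rw [hh, radialContraction_iterate]
    exact hk₀ k₀ le_rfl x hx

end RadialContraction

/-- A union of countable compact sets accumulating only at a countable compact set has
countable compact closure. -/
theorem countable_isCompact_closure_iUnion {X : Type*} [MetricSpace X] [ProperSpace X]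
    {A : Set X} (hA : IsCompact A) (hAne : A.Nonempty) (hAc : A.Countable) {C : ℕ → Set X}
    (hC : ∀ i, IsClosed (C i)) (hCc : ∀ i, (C i).Countable)
    (hCA : ∀ i, ∀ x ∈ C i, infDist x A < 1 / ((i : ℝ) + 1)) :
    (closure (⋃ i, C i)).Countable ∧ IsCompact (closure (⋃ i, C i)) := by
  have hsub : ∀ N : ℕ, closure (⋃ i, C i) ⊆
      cthickening (1 / ((N : ℝ) + 1)) A ∪ ⋃ i ∈ Finset.range N, C i := by
    intro N
    refine closure_minimal (iUnion_subset fun i x hx => ?_)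
      (isClosed_cthickening.union (isClosed_biUnion_finset fun i _ => hC i))
    rcases lt_or_ge i N with hi | hi
    · exact Or.inr (mem_biUnion (Finset.mem_coe.2 (Finset.mem_range.2 hi)) hx)
    · refine Or.inl (thickening_subset_cthickening _ _ ?_)
      rw [mem_thickening_iff_infDist_lt hAne]
      exact (hCA i x hx).trans_le (one_div_le_one_div_of_le (by positivity) (by gcongr))
  constructor
  · refine (hAc.union (countable_iUnion hCc)).mono fun x hx => ?_
    by_contra hcon
    rw [mem_union, not_or, mem_iUnion, not_exists] at hcon
    have hpos := (hA.isClosed.notMem_iff_infDist_pos hAne).1 hcon.1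
    obtain ⟨N, hN⟩ := exists_nat_one_div_lt hpos
    rcases hsub N hx with h | h
    · rw [hA.cthickening_eq_biUnion_closedBall (by positivity)] at h
      obtain ⟨y, hy, hxy⟩ := mem_iUnion₂.1 h
      linarith [infDist_le_dist_of_mem (x := x) hy, mem_closedBall.1 hxy]
    · obtain ⟨i, _, hi⟩ := mem_iUnion₂.1 h
      exact hcon.2 i hi
  · exact hA.cthickening.of_isClosed_subset isClosed_closure (by simpa using hsub 0)

/-- Dynamical σ-completeness of the ideal generated by countable
compact sets in ℝⁿ. -/
theorem stmt18 (n : ℕ) (hn : 1 ≤ n)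
    (a : Set (EuclideanSpace ℝ (Fin n)))
    (ha : (closure a).Countable) (hac : IsCompact (closure a))
    (b : ℕ → Set (EuclideanSpace ℝ (Fin n)))
    (hb : ∀ i, (closure (b i)).Countable)
    (hbc : ∀ i, IsCompact (closure (b i))) :
    ∃ h : ℕ → (EuclideanSpace ℝ (Fin n) ≃ₜ EuclideanSpace ℝ (Fin n)),
      (∀ i, ∀ x ∈ a, h i x = x) ∧
      (closure (⋃ i, (h i) '' (b i))).Countable ∧
      IsCompact (closure (⋃ i, (h i) '' (b i))) := by
  have h0 : (0 : EuclideanSpace ℝ (Fin n)) ∈ insert 0 (closure a) := mem_insert _ _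
  choose h hfix hnear using fun i : ℕ => exists_homeomorph_fixing_infDist_lt h0 (hbc i) (hb i)
    (show (0 : ℝ) < 1 / ((i : ℝ) + 1) by positivity)
  obtain ⟨h1, h2⟩ := countable_isCompact_closure_iUnion (hac.insert 0) ⟨0, h0⟩ (ha.insert 0)
    (C := fun i => h i '' closure (b i)) (fun i => ((hbc i).image (h i).continuous).isClosed)
    (fun i => (hb i).image _) (by rintro i _ ⟨x, hx, rfl⟩; exact hnear i x hx)
  have hsub : closure (⋃ i, h i '' b i) ⊆ closure (⋃ i, h i '' closure (b i)) :=
    closure_mono (iUnion_mono fun i => image_mono subset_closure)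
  exact ⟨h, fun i x hx => hfix i x (mem_insert_of_mem _ (subset_closure hx)), h1.mono hsub,
    h2.of_isClosed_subset isClosed_closure hsub⟩
end

section
/- Every compact totally disconnected subset of ℝ² is contained in a nonempty compact perfect totally disconnected subset of ℝ². -/
open Topology Filter Set Metric

instance Pi.perfectSpace_nat_bool : PerfectSpace (ℕ → Bool) := by
  refine ⟨preperfect_iff_nhds.2 fun u _ U hU => ?_⟩
  have h : Tendsto (fun n => Function.update u n (!u n)) atTop (𝓝 u) := by
    refine tendsto_pi_nhds.2 fun i => tendsto_const_nhds.congr' ?_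
    filter_upwards [eventually_gt_atTop i] with n hn
    simp [Function.update_of_ne hn.ne]
  obtain ⟨n, hn⟩ := (h.eventually_mem hU).exists
  refine ⟨_, ⟨hn, mem_univ _⟩, fun hu => ?_⟩
  simpa using congrFun hu n

/-- The Cantor space embeds continuously in the unit interval, with `0` in its image. -/
theorem exists_nat_bool_embedding_unitInterval :
    ∃ φ : (ℕ → Bool) → ℝ, Continuous φ ∧ Function.Injective φ ∧
      (∀ u, φ u ∈ Icc (0 : ℝ) 1) ∧ ∃ u, φ u = 0 :=
  ⟨fun u => cantorSetHomeomorphNatToBool.symm u,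
    continuous_subtype_val.comp cantorSetHomeomorphNatToBool.symm.continuous,
    Subtype.val_injective.comp cantorSetHomeomorphNatToBool.symm.injective,
    fun u => cantorSet_subset_unitInterval (cantorSetHomeomorphNatToBool.symm u).2,
    cantorSetHomeomorphNatToBool ⟨0, zero_mem_cantorSet⟩, by simp⟩

/-- On a compact set there is a continuous function vanishing only at accumulation points and
bounded by the distance to every other point of the set. -/
theorem IsCompact.exists_isolation_radius {X : Type*} [MetricSpace X] [NoncompactSpace X]
    {a : Set X} (ha : IsCompact a) :
    ∃ d : X → ℝ, ContinuousOn d a ∧ (∀ p, 0 ≤ d p) ∧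
      (∀ p ∈ a, ∀ q ∈ a, p ≠ q → d p ≤ dist p q) ∧
      ∀ p ∈ a, d p = 0 → AccPt p (𝓟 a) := by
  obtain ⟨z, hz⟩ := (ne_univ_iff_exists_notMem a).1 ha.ne_univ
  let d : X → ℝ := fun p => infDist p (insert z (a \ {p}))
  have h0 : ∀ p, 0 ≤ d p := fun p => infDist_nonneg
  have hle : ∀ p ∈ a, ∀ q ∈ a, p ≠ q → d p ≤ dist p q := fun p _ q hq hpq =>
    infDist_le_dist_of_mem (mem_insert_of_mem _ ⟨hq, hpq.symm⟩)
  refine ⟨d, ?_, h0, hle, fun p hp hd => ?_⟩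
  · refine LipschitzOnWith.continuousOn (K := 1) (LipschitzOnWith.of_le_add fun p hp q hq => ?_)
    rcases eq_or_ne p q with rfl | hpq
    · simp
    · linarith [hle p hp q hq hpq, h0 q]
  · have hcl : p ∈ closure (insert z (a \ {p})) :=
      (mem_closure_iff_infDist_zero (insert_nonempty _ _)).2 hd
    rw [insert_eq, closure_union, closure_singleton] at hcl
    rcases hcl with rfl | hcl
    · exact absurd hp hz
    · rwa [accPt_principal_iff_clusterPt, ← mem_closure_iff_clusterPt]

/-- In a nontrivial real normed space, every compact totally disconnected set is contained
in a compact perfect totally disconnected set. -/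
theorem IsCompact.exists_perfect_isTotallyDisconnected_superset
    {E : Type*} [NormedAddCommGroup E] [NormedSpace ℝ E] [Nontrivial E] {a : Set E}
    (ha : IsCompact a) (haT : IsTotallyDisconnected a) :
    ∃ c : Set E, a ⊆ c ∧ IsCompact c ∧ Perfect c ∧ IsTotallyDisconnected c := by
  have : NoncompactSpace E := NormedSpace.noncompactSpace ℝ E
  obtain ⟨v, hv⟩ := exists_norm_eq E zero_le_one
  have hv0 : v ≠ 0 := norm_ne_zero_iff.1 (by simp [hv])
  obtain ⟨d, hdc, hd0, hdle, hdacc⟩ := ha.exists_isolation_radius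
  obtain ⟨φ, hφc, hφi, hφI, u₀, hu₀⟩ := exists_nat_bool_embedding_unitInterval
  let f : E × (ℕ → Bool) → E := fun x => x.1 + (d x.1 / 4 * φ x.2) • v
  have hf : ContinuousOn f (a ×ˢ univ) := by
    have : ContinuousOn (fun x : E × (ℕ → Bool) => d x.1) (a ×ˢ univ) :=
      hdc.comp continuousOn_fst fun x hx => hx.1
    exact continuousOn_fst.add
      (((this.div_const 4).mul (hφc.comp continuous_snd).continuousOn).smul continuousOn_const)
  have hfib : ∀ p, Continuous fun u => f (p, u) := fun p => by
    simp only [f]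
    fun_prop
  have hinj : ∀ p, d p ≠ 0 → Function.Injective fun u => f (p, u) := fun p hp u w huw =>
    hφi (mul_left_cancel₀ (div_ne_zero hp four_ne_zero)
      (smul_left_injective ℝ hv0 (add_left_cancel huw)))
  have hsub : a ⊆ f '' (a ×ˢ univ) := fun p hp => ⟨(p, u₀), ⟨hp, mem_univ _⟩, by simp [f, hu₀]⟩
  have hK : IsCompact (f '' (a ×ˢ univ)) := (ha.prod isCompact_univ).image_of_continuousOn hf
  refine ⟨f '' (a ×ˢ univ), hsub, hK, ⟨hK.isClosed, ?_⟩, fun S hS hSc => ?_⟩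
  · rintro _ ⟨⟨p, u⟩, ⟨hp, -⟩, rfl⟩
    by_cases hd : d p = 0
    · have : f (p, u) = p := by simp [f, hd]
      rw [this]
      exact (hdacc p hp hd).mono (principal_mono.2 hsub)
    · have := (PerfectSpace.univ_preperfect u (mem_univ u)).map
        (hfib p).continuousAt (hinj p hd)
      refine this.mono ?_
      rw [map_principal, principal_mono]
      rintro _ ⟨w, -, rfl⟩
      exact ⟨(p, w), ⟨hp, mem_univ _⟩, rfl⟩
  · have hdist : ∀ p ∈ a, ∀ q ∈ a, ∀ u w, dist p q ≤ 2 * dist (f (p, u)) (f (q, w)) := by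
      intro p hp q hq u w
      rcases eq_or_ne p q with rfl | hpq
      · simp
      have h1 := hdle p hp q hq hpq
      have h2 := hdle q hq p hp hpq.symm
      rw [dist_comm] at h2
      have h3 : |d p / 4 * φ u - d q / 4 * φ w| ≤ dist p q / 2 := by
        have := hφI u
        have := hφI w
        rw [mem_Icc] at *
        have := hd0 p
        have := hd0 q
        rw [abs_le]
        constructor <;> nlinarith
      have h4 : p - q = (f (p, u) - f (q, w)) - (d p / 4 * φ u - d q / 4 * φ w) • v := by
        simp only [f, sub_smul]
        abel
      have h5 : dist p q ≤ dist (f (p, u)) (f (q, w)) + |d p / 4 * φ u - d q / 4 * φ w| := by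
        rw [dist_eq_norm p q, h4, dist_eq_norm]
        refine (norm_sub_le _ _).trans_eq ?_
        rw [norm_smul, hv, mul_one, Real.norm_eq_abs]
      linarith
    choose! g hga hg using fun x (hx : x ∈ S) =>
      show ∃ p, p ∈ a ∧ ∃ u, f (p, u) = x by
        obtain ⟨⟨p, u⟩, ⟨hp, -⟩, h⟩ := hS hx
        exact ⟨p, hp, u, h⟩
    have hgc : ContinuousOn g S := by
      refine LipschitzOnWith.continuousOn (K := 2) (LipschitzOnWith.of_dist_le_mul ?_)
      intro x hx y hy
      obtain ⟨u, hu⟩ := hg x hx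
      obtain ⟨w, hw⟩ := hg y hy
      simpa [hu, hw] using hdist _ (hga x hx) _ (hga y hy) u w
    have hgS : (g '' S).Subsingleton :=
      haT _ (image_subset_iff.2 hga) (hSc.image g hgc)
    intro x hx y hy
    have hSr : S ⊆ range fun u => f (g x, u) := fun t ht => by
      rw [hgS (mem_image_of_mem g hx) (mem_image_of_mem g ht)]
      exact hg t ht
    by_cases hd : d (g x) = 0
    · obtain ⟨u, hu⟩ := hSr hx
      obtain ⟨w, hw⟩ := hSr hy
      rw [← hu, ← hw]
      simp [f, hd]
    · have hemb := ((hfib (g x)).isClosedEmbedding (hinj _ hd)).isEmbedding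
      exact hemb.isTotallyDisconnected_range.2 inferInstance S hSr hSc hx hy

/-- Every compact totally disconnected subset of the plane is
contained in a nonempty compact perfect totally disconnected subset of the
plane. -/
theorem stmt19 (a : Set (EuclideanSpace ℝ (Fin 2)))
    (hac : IsCompact a) (haT : IsTotallyDisconnected a) :
    ∃ c : Set (EuclideanSpace ℝ (Fin 2)),
      a ⊆ c ∧ c.Nonempty ∧ IsCompact c ∧ Perfect c ∧ IsTotallyDisconnected c := by
  rcases a.eq_empty_or_nonempty with rfl | hne
  · obtain ⟨c, hc, h⟩ := (isCompact_singleton (x := (0 : EuclideanSpace ℝ (Fin 2)))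
      ).exists_perfect_isTotallyDisconnected_superset isTotallyDisconnected_singleton
    exact ⟨c, empty_subset _, ⟨0, hc rfl⟩, h⟩
  · obtain ⟨c, hc, h⟩ := hac.exists_perfect_isTotallyDisconnected_superset haT
    exact ⟨c, hc, hne.mono hc, h⟩
end
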